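/- arXiv:2012.08964 — 2 statements merged into one kernel-verified Lean document; each statement's English description precedes it below -/
import Mathlib

section
/- Quantitative (p,q)-Theorem with large lower bound on p: For every dimension d ≥ 1 and every integer p ≥ d(d+3)/2 there is an integer H = H(p,d) with the following property. Let 𝒞 be a finite family of convex sets in ℝ^d, each containing an ellipsoid of volume one, and assume that among any p members of 𝒞 there exist d(d+3)/2 whose intersection contains an ellipsoid of volume one. Then there exists a finite family T of ellipsoids, each of volume one, with |T| ≤ H, such that every member of 𝒞 contains at least one ellipsoid from T. -/
open MeasureTheory

/-- An ellipsoid is the image of the closed Euclidean unit ball under an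
invertible affine transformation. -/
def IsEllipsoid {d : ℕ} (E : Set (EuclideanSpace ℝ (Fin d))) : Prop :=
  ∃ L : EuclideanSpace ℝ (Fin d) ≃ᵃ[ℝ] EuclideanSpace ℝ (Fin d),
    E = L '' Metric.closedBall 0 1

/-- Ramsey's theorem for two-colourings of the `r`-subsets of a finite set. -/
theorem exists_ramsey_number (r p m : ℕ) : ∃ N : ℕ, ∀ (n : ℕ) (S : Finset (Fin n)),
    N ≤ S.card → ∀ good : Finset (Fin n) → Prop,
      (∃ T ⊆ S, T.card = p ∧ ∀ U ⊆ T, U.card = r → ¬ good U) ∨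
      (∃ T ⊆ S, T.card = m ∧ ∀ U ⊆ T, U.card = r → good U) := by
  induction r generalizing p m with
  | zero =>
    refine ⟨max p m, fun n S hS good => ?_⟩
    by_cases h : good ∅
    · obtain ⟨T, hT, hc⟩ := Finset.exists_subset_card_eq (le_trans (le_max_right p m) hS)
      refine Or.inr ⟨T, hT, hc, fun U _ hU => ?_⟩
      rwa [Finset.card_eq_zero.1 hU]
    · obtain ⟨T, hT, hc⟩ := Finset.exists_subset_card_eq (le_trans (le_max_left p m) hS)
      refine Or.inl ⟨T, hT, hc, fun U _ hU => ?_⟩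
      rwa [Finset.card_eq_zero.1 hU]
  | succ r ihr =>
    have step : ∀ (n : ℕ) (P : Finset (Fin n) → Prop) (v : Fin n) (T A : Finset (Fin n)),
        T ⊆ A → (∀ U ⊆ A, U.card = r → P (insert v U)) →
        (∀ U ⊆ T, U.card = r + 1 → P U) → ∀ U ⊆ insert v T, U.card = r + 1 → P U := by
      intro n P v T A hTA hA hT U hU hc
      by_cases hv : v ∈ U
      · rw [← Finset.insert_erase hv]
        refine hA _ (fun x hx => hTA ?_) (by rw [Finset.card_erase_of_mem hv, hc]; rfl)
        have := hU (Finset.mem_of_mem_erase hx)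
        exact (Finset.mem_insert.1 this).resolve_left (Finset.ne_of_mem_erase hx)
      · refine hT U (fun x hx => ?_) hc
        exact (Finset.mem_insert.1 (hU hx)).resolve_left (fun h => hv (h ▸ hx))
    induction p generalizing m with
    | zero =>
      refine ⟨0, fun n S _ good => Or.inl ⟨∅, by simp, rfl, fun U hU hc => ?_⟩⟩
      simp [Finset.subset_empty.1 hU] at hc
    | succ p ihp =>
      induction m with
      | zero =>
        refine ⟨0, fun n S _ good => Or.inr ⟨∅, by simp, rfl, fun U hU hc => ?_⟩⟩
        simp [Finset.subset_empty.1 hU] at hc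
      | succ m ihm =>
        obtain ⟨N₁, h₁⟩ := ihp (m + 1)
        obtain ⟨N₂, h₂⟩ := ihm
        obtain ⟨N, h⟩ := ihr N₁ N₂
        refine ⟨N + 1, fun n S hS good => ?_⟩
        obtain ⟨v, hv⟩ : S.Nonempty := Finset.card_pos.1 (by omega)
        have hcard : N ≤ (S.erase v).card := by rw [Finset.card_erase_of_mem hv]; omega
        rcases h n (S.erase v) hcard (fun T => good (insert v T)) with
          ⟨A, hAS, hA, hbad⟩ | ⟨A, hAS, hA, hgood⟩
        · have hAS' : A ⊆ S := hAS.trans (Finset.erase_subset v S)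
          rcases h₁ n A hA.ge good with ⟨T, hTA, hT, hTbad⟩ | ⟨T, hTA, hT, hTgood⟩
          · refine Or.inl ⟨insert v T, Finset.insert_subset hv (hTA.trans hAS'), ?_,
              step n (fun U => ¬ good U) v T A hTA hbad hTbad⟩
            rw [Finset.card_insert_of_notMem
              (fun hvT => Finset.notMem_erase v S (hAS (hTA hvT))), hT]
          · exact Or.inr ⟨T, hTA.trans hAS', hT, hTgood⟩
        · have hAS' : A ⊆ S := hAS.trans (Finset.erase_subset v S)
          rcases h₂ n A hA.ge good with ⟨T, hTA, hT, hTbad⟩ | ⟨T, hTA, hT, hTgood⟩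
          · exact Or.inl ⟨T, hTA.trans hAS', hT, hTbad⟩
          · refine Or.inr ⟨insert v T, Finset.insert_subset hv (hTA.trans hAS'), ?_,
              step n good v T A hTA hgood hTgood⟩
            rw [Finset.card_insert_of_notMem
              (fun hvT => Finset.notMem_erase v S (hAS (hTA hvT))), hT]

/-- If an event under a product weight has mass at least `β`, then after resampling only the
coordinates in `B` it still has mass at least `β` for some choice of the other coordinates. -/
theorem exists_resample_mass_ge {ι κ : Type*} [Fintype ι] [Fintype κ] [DecidableEq κ]
    (w : ι → ℝ) (hw : ∀ i, 0 ≤ w i) (hpos : 0 < ∑ i, w i) (B : Finset κ)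
    (Z : (κ → ι) → Prop) [DecidablePred Z] (β : ℝ)
    (h : β ≤ ∑ y : κ → ι, if Z y then ∏ k, w (y k) else 0) :
    ∃ y₀ : κ → ι, β ≤ ∑ z : κ → ι, if Z (B.piecewise z y₀) then ∏ k, w (z k) else 0 := by
  classical
  set W : (κ → ι) → ℝ := fun y => ∏ k, w (y k) with hW
  have hW0 : ∀ y, 0 ≤ W y := fun y => Finset.prod_nonneg fun k _ => hw _
  have htot : 0 < ∑ y, W y := by
    have : ∑ y, W y = (∑ i, w i) ^ Fintype.card κ := by
      simp only [hW, ← Fintype.piFinset_univ]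
      rw [Finset.sum_prod_piFinset]
      simp
    rw [this]
    positivity
  let e : (κ → ι) × (κ → ι) ≃ (κ → ι) × (κ → ι) :=
    Function.Involutive.toPerm (fun q => (B.piecewise q.2 q.1, B.piecewise q.1 q.2)) (by
      rintro ⟨y, z⟩
      ext k <;> by_cases hk : k ∈ B <;> simp [hk])
  have he : ∀ q, W (e q).1 * W (e q).2 = W q.1 * W q.2 := by
    rintro ⟨y, z⟩
    simp only [hW, ← Finset.prod_mul_distrib]
    refine Finset.prod_congr rfl fun k _ => ?_
    change w (B.piecewise z y k) * w (B.piecewise y z k) = _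
    by_cases hk : k ∈ B <;> simp [hk, mul_comm]
  have key : ∑ y, W y * ∑ z, (if Z (B.piecewise z y) then W z else 0) =
      ∑ y, W y * ∑ u, (if Z u then W u else 0) := by
    have h1 : ∀ q : (κ → ι) × (κ → ι),
        W q.1 * (if Z (B.piecewise q.2 q.1) then W q.2 else 0) =
          (fun r : (κ → ι) × (κ → ι) => (if Z r.1 then W r.1 else 0) * W r.2) (e q) := by
      intro q
      have h2 : (e q).1 = B.piecewise q.2 q.1 := rfl
      have h3 := he q
      simp only
      rw [h2] at h3 ⊢
      split_ifs
      · exact h3.symm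
      · simp
    calc _ = ∑ q : (κ → ι) × (κ → ι),
          W q.1 * (if Z (B.piecewise q.2 q.1) then W q.2 else 0) := by
            simp only [Finset.mul_sum, Fintype.sum_prod_type]
      _ = ∑ r : (κ → ι) × (κ → ι), (if Z r.1 then W r.1 else 0) * W r.2 := by
            simp only [h1]
            exact Equiv.sum_comp e (fun r => (if Z r.1 then W r.1 else 0) * W r.2)
      _ = _ := by
            rw [Fintype.sum_prod_type, ← Finset.sum_mul, Finset.sum_mul_sum, Finset.sum_comm]
            exact Finset.sum_congr rfl fun _ _ => Finset.sum_congr rfl fun _ _ => mul_comm _ _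
  by_contra! hcon
  have : ∑ y, W y * ∑ z, (if Z (B.piecewise z y) then W z else 0) < ∑ y, W y * β := by
    obtain ⟨y, -, hy⟩ := Finset.exists_ne_zero_of_sum_ne_zero htot.ne'
    exact Finset.sum_lt_sum (fun y _ => mul_le_mul_of_nonneg_left (hcon y).le (hW0 y))
      ⟨y, Finset.mem_univ _, mul_lt_mul_of_pos_left (hcon y) ((hW0 y).lt_of_ne' hy)⟩
  rw [key, ← Finset.sum_mul, ← Finset.sum_mul] at this
  exact absurd (lt_of_mul_lt_mul_left this htot.le) (not_lt.2 h)

theorem sum_prod_comp_eq_pow {ι : Type*} [Fintype ι] (M : ℕ) (w : ι → ℝ) :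
    ∑ z : Fin M → ι, ∏ k, w (z k) = (∑ i, w i) ^ M := by
  rw [← Fintype.piFinset_univ, Finset.sum_prod_piFinset]
  simp

/-- A point of least norm of a set (an arbitrary point if there is none). -/
noncomputable def minNormPoint {E : Type*} [NormedAddCommGroup E] (S : Set E) : E :=
  Classical.epsilon fun x => x ∈ S ∧ ∀ y ∈ S, ‖x‖ ≤ ‖y‖

section FiniteDimensional

variable {E : Type*} [NormedAddCommGroup E] [InnerProductSpace ℝ E] [FiniteDimensional ℝ E]

theorem minNormPoint_spec {S : Set E} (hS : IsClosed S) (hne : S.Nonempty) :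
    minNormPoint S ∈ S ∧ ∀ y ∈ S, ‖minNormPoint S‖ ≤ ‖y‖ := by
  refine Classical.epsilon_spec (p := fun x => x ∈ S ∧ ∀ y ∈ S, ‖x‖ ≤ ‖y‖) ?_
  obtain ⟨x, hx, h⟩ := hS.exists_infDist_eq_dist hne 0
  refine ⟨x, hx, fun y hy => ?_⟩
  have := Metric.infDist_le_dist_of_mem (x := (0 : E)) hy
  rwa [h, dist_zero_left, dist_zero_left] at this

theorem eq_minNormPoint {S : Set E} (hS : IsClosed S) (hc : Convex ℝ S) {x : E} (hx : x ∈ S)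
    (h : ‖x‖ ≤ ‖minNormPoint S‖) : x = minNormPoint S := by
  obtain ⟨hm, hmin⟩ := minNormPoint_spec hS ⟨x, hx⟩
  set m := minNormPoint S
  have h1 := hmin _ (hc hx hm (by norm_num : (0 : ℝ) ≤ 1 / 2) (by norm_num : (0 : ℝ) ≤ 1 / 2)
    (by norm_num))
  rw [← smul_add, norm_smul, Real.norm_of_nonneg (by norm_num)] at h1
  have h2 := parallelogram_law_with_norm ℝ x m
  have h3 : ‖x - m‖ * ‖x - m‖ ≤ 0 := by nlinarith [norm_nonneg x, norm_nonneg m]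
  have h4 : ‖x - m‖ = 0 := by nlinarith [norm_nonneg (x - m)]
  exact sub_eq_zero.1 (norm_eq_zero.1 h4)

/-- Among `dim E + 1` intersecting closed convex sets, some set contains the point of least norm
of the intersection of the others. -/
theorem exists_minNormPoint_mem (K : Fin (Module.finrank ℝ E + 1) → Set E)
    (hcl : ∀ k, IsClosed (K k)) (hc : ∀ k, Convex ℝ (K k)) (hne : (⋂ k, K k).Nonempty) :
    ∃ j, minNormPoint (⋂ (k) (_ : k ≠ j), K k) ∈ K j := by
  by_contra! hcon
  obtain ⟨hm, hmin⟩ := minNormPoint_spec (isClosed_iInter hcl) hne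
  set m := minNormPoint (⋂ k, K k)
  rw [Set.mem_iInter] at hm
  let F : Option (Fin (Module.finrank ℝ E + 1)) → Set E := fun o => o.elim (Metric.ball 0 ‖m‖) K
  have hF : (⋂ o ∈ (Finset.univ : Finset (Option (Fin (Module.finrank ℝ E + 1)))),
      F o).Nonempty := by
    refine Convex.helly_theorem (𝕜 := ℝ) (by simp) ?_ ?_
    · rintro (_ | k) -
      · exact convex_ball 0 _
      · exact hc k
    · intro I _ hI
      obtain ⟨o, ho⟩ : ∃ o, o ∉ I := by
        by_contra! h
        rw [Finset.eq_univ_of_forall h] at hI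
        simp at hI
      rcases o with _ | j
      · refine ⟨m, Set.mem_iInter₂.2 ?_⟩
        rintro (_ | k) hk
        · exact absurd hk ho
        · exact hm k
      · have hcl' : IsClosed (⋂ (k) (_ : k ≠ j), K k) :=
          isClosed_iInter fun k => isClosed_iInter fun _ => hcl k
        have hc' : Convex ℝ (⋂ (k) (_ : k ≠ j), K k) :=
          convex_iInter fun k => convex_iInter fun _ => hc k
        have hm' : m ∈ ⋂ (k) (_ : k ≠ j), K k := Set.mem_iInter₂.2 fun k _ => hm k
        have hs := minNormPoint_spec hcl' ⟨m, hm'⟩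
        refine ⟨minNormPoint (⋂ (k) (_ : k ≠ j), K k), Set.mem_iInter₂.2 ?_⟩
        rintro (_ | k) hk
        · change _ ∈ Metric.ball 0 ‖m‖
          rw [mem_ball_zero_iff]
          refine (hs.2 m hm').lt_of_ne fun h => hcon j ?_
          rw [← eq_minNormPoint hcl' hc' hm' h.ge]
          exact hm j
        · exact Set.mem_iInter₂.1 hs.1 k (fun h => ho (h ▸ hk))
  obtain ⟨x, hx⟩ := hF
  have hx' : ∀ o, x ∈ F o := fun o => Set.mem_iInter₂.1 hx o (Finset.mem_univ o)
  have h1 : x ∈ Metric.ball 0 ‖m‖ := hx' none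
  rw [mem_ball_zero_iff] at h1
  exact absurd (hmin x (Set.mem_iInter.2 fun k => hx' (some k))) (not_le.2 h1)

/-- If every `M`-tuple of indices contains `dim E + 1` disjoint groups of positions whose associated
closed convex sets intersect, then one point lies in a positive proportion of the sets associated
with a fixed group of positions. -/
theorem exists_mem_positive_fraction {ι : Type*} [Fintype ι] {M : ℕ}
    (K : Finset (Fin M) → (Fin M → ι) → Set E)
    (hcl : ∀ B f, IsClosed (K B f)) (hc : ∀ B f, Convex ℝ (K B f))
    (hloc : ∀ B f g, (∀ k ∈ B, f k = g k) → K B f = K B g)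
    (hyp : ∀ f, ∃ B : Fin (Module.finrank ℝ E + 1) → Finset (Fin M), (∀ k, (B k).Nonempty) ∧
      Pairwise (Function.onFun Disjoint B) ∧ (⋂ k, K (B k) f).Nonempty)
    (w : ι → ℝ) (hw : ∀ i, 0 ≤ w i) (hpos : 0 < ∑ i, w i) :
    ∃ A : Finset (Fin M), A.Nonempty ∧ ∃ x : E, ∀ [DecidablePred fun z => x ∈ K A z],
      (∑ i, w i) ^ M / Fintype.card ((Fin (Module.finrank ℝ E + 1) → Finset (Fin M)) ×
        Fin (Module.finrank ℝ E + 1)) ≤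
        ∑ z : Fin M → ι, if x ∈ K A z then ∏ k, w (z k) else 0 := by
  classical
  set Str := (Fin (Module.finrank ℝ E + 1) → Finset (Fin M)) × Fin (Module.finrank ℝ E + 1)
  set β : ℝ := (∑ i, w i) ^ M / Fintype.card Str with hβ
  have hStr : (0 : ℝ) < Fintype.card Str := by
    have : Nonempty Str := ⟨(fun _ => ∅, 0)⟩
    exact_mod_cast Fintype.card_pos
  have hβ0 : 0 < β := by positivity
  let Z : Str → (Fin M → ι) → Prop := fun s f => (∀ k, (s.1 k).Nonempty) ∧
    Pairwise (Function.onFun Disjoint s.1) ∧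
    minNormPoint (⋂ (k) (_ : k ≠ s.2), K (s.1 k) f) ∈ K (s.1 s.2) f
  have hZ : ∀ f, ∃ s, Z s f := by
    intro f
    obtain ⟨B, hB, hd, hn⟩ := hyp f
    obtain ⟨j, hj⟩ := exists_minNormPoint_mem (fun k => K (B k) f) (fun k => hcl _ _)
      (fun k => hc _ _) hn
    exact ⟨(B, j), hB, hd, hj⟩
  obtain ⟨s, hs⟩ : ∃ s, β ≤ ∑ f : Fin M → ι, if Z s f then ∏ k, w (f k) else 0 := by
    by_contra! hcon
    have h1 : ∑ s : Str, ∑ f : Fin M → ι, (if Z s f then ∏ k, w (f k) else 0) < ∑ s : Str, β :=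
      Finset.sum_lt_sum_of_nonempty ⟨(fun _ => ∅, 0), Finset.mem_univ _⟩ fun s _ => hcon s
    have h2 : (∑ i, w i) ^ M ≤
        ∑ s : Str, ∑ f : Fin M → ι, (if Z s f then ∏ k, w (f k) else 0) := by
      rw [← sum_prod_comp_eq_pow, Finset.sum_comm]
      refine Finset.sum_le_sum fun f _ => ?_
      obtain ⟨s, hs⟩ := hZ f
      have h0 : ∀ s : Str, 0 ≤ if Z s f then ∏ k, w (f k) else 0 := fun s => by
        split_ifs
        · exact Finset.prod_nonneg fun k _ => hw _
        · exact le_rfl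
      refine le_trans ?_ (Finset.single_le_sum (fun s _ => h0 s) (Finset.mem_univ s))
      rw [if_pos hs]
    rw [Finset.sum_const, nsmul_eq_mul, hβ, Finset.card_univ, mul_div_cancel₀ _ hStr.ne'] at h1
    exact absurd h2 (not_le.2 h1)
  obtain ⟨f, -, hf⟩ := Finset.exists_ne_zero_of_sum_ne_zero (hβ0.trans_le hs).ne'
  obtain ⟨hne, hd, -⟩ : Z s f := by
    by_contra h
    exact hf (if_neg h)
  obtain ⟨y₀, hy₀⟩ := exists_resample_mass_ge w hw hpos (s.1 s.2) (Z s) β hs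
  refine ⟨s.1 s.2, hne _, minNormPoint (⋂ (k) (_ : k ≠ s.2), K (s.1 k) y₀), fun {_} => ?_⟩
  refine hy₀.trans (Finset.sum_le_sum fun z _ => ?_)
  have h1 : ∀ k ≠ s.2, K (s.1 k) ((s.1 s.2).piecewise z y₀) = K (s.1 k) y₀ := fun k hk =>
    hloc _ _ _ fun i hi => Finset.piecewise_eq_of_notMem _ _ _
      (Finset.disjoint_left.1 (hd hk) hi)
  have h2 : K (s.1 s.2) ((s.1 s.2).piecewise z y₀) = K (s.1 s.2) z :=
    hloc _ _ _ fun i hi => Finset.piecewise_eq_of_mem _ _ _ hi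
  have h3 : Z s ((s.1 s.2).piecewise z y₀) →
      minNormPoint (⋂ (k) (_ : k ≠ s.2), K (s.1 k) y₀) ∈ K (s.1 s.2) z := by
    rintro ⟨-, -, h⟩
    rwa [h2, Set.iInter₂_congr h1] at h
  have h4 : 0 ≤ ∏ k, w (z k) := Finset.prod_nonneg fun k _ => hw _
  split_ifs with h5 h6 h6
  · exact le_rfl
  · exact absurd (h3 h5) h6
  · exact h4
  · exact le_rfl

/-- Carathéodory's theorem for indexed families of points. -/
theorem exists_subset_card_le_mem_convexHull {κ : Type*} [DecidableEq κ] (z : κ → E) (R : Set κ)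
    {c : E} (hx : c ∈ convexHull ℝ (z '' R)) :
    ∃ B : Finset κ, (B : Set κ) ⊆ R ∧ B.card ≤ Module.finrank ℝ E + 1 ∧
      c ∈ convexHull ℝ (z '' B) := by
  rw [convexHull_eq_union] at hx
  simp only [Set.mem_iUnion] at hx
  obtain ⟨t, ht, hind, hc⟩ := hx
  choose g hgR hg using fun e : t => ht e.2
  refine ⟨Finset.univ.image g, ?_, Finset.card_image_le.trans ?_, ?_⟩
  · intro k hk
    obtain ⟨e, -, rfl⟩ := Finset.mem_image.1 (Finset.mem_coe.1 hk)
    exact hgR e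
  · have := hind.card_le_finrank_succ
    exact this.trans (Nat.add_le_add_right (Submodule.finrank_le _) 1)
  · refine convexHull_mono (fun e he => ?_) hc
    exact ⟨g ⟨e, he⟩, by simp, hg ⟨e, he⟩⟩

/-- Given more than `(dim E + 1) * s` points, some point stays in their convex hull whenever at most
`s` of them are deleted. -/
theorem exists_mem_convexHull_compl {M s : ℕ} (hM : (Module.finrank ℝ E + 1) * s < M)
    (z : Fin M → E) :
    ∃ c, ∀ R : Finset (Fin M), R.card ≤ s → c ∈ convexHull ℝ (z '' (R : Set (Fin M))ᶜ) := by
  classical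
  have h : (⋂ R ∈ (Finset.univ.filter fun R : Finset (Fin M) => R.card ≤ s),
      convexHull ℝ (z '' (R : Set (Fin M))ᶜ)).Nonempty := by
    refine Convex.helly_theorem' (𝕜 := ℝ) (fun _ _ => convex_convexHull ℝ _) fun I hI hcard => ?_
    have h1 : (I.biUnion id).card ≤ I.card * s :=
      Finset.card_biUnion_le_card_mul _ _ _ fun R hR => (Finset.mem_filter.1 (hI hR)).2
    obtain ⟨k, hk⟩ : ∃ k, k ∉ I.biUnion id := by
      by_contra! hcon
      rw [Finset.eq_univ_of_forall hcon, Finset.card_univ, Fintype.card_fin] at h1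
      have := Nat.mul_le_mul_right s hcard
      omega
    refine ⟨z k, Set.mem_iInter₂.2 fun R hR => subset_convexHull ℝ _ ⟨k, fun hkR => hk ?_, rfl⟩⟩
    exact Finset.mem_biUnion.2 ⟨R, hR, hkR⟩
  obtain ⟨c, hc⟩ := h
  exact ⟨c, fun R hR => Set.mem_iInter₂.1 hc R (by simpa using hR)⟩

/-- A weak form of Tverberg's theorem. -/
theorem exists_disjoint_convexHull_inter {M : ℕ} (r : ℕ)
    (hM : (Module.finrank ℝ E + 1) * (r * (Module.finrank ℝ E + 1)) < M) (z : Fin M → E) :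
    ∃ B : Fin r → Finset (Fin M), Pairwise (Function.onFun Disjoint B) ∧
      (⋂ k, convexHull ℝ (z '' (B k : Set (Fin M)))).Nonempty := by
  classical
  obtain ⟨c, hc⟩ := exists_mem_convexHull_compl hM z
  have key : ∀ n ≤ r, ∃ B : ℕ → Finset (Fin M), (∀ k < n, (B k).card ≤ Module.finrank ℝ E + 1) ∧
      (∀ k < n, ∀ l < k, Disjoint (B l) (B k)) ∧
      ∀ k < n, c ∈ convexHull ℝ (z '' (B k : Set (Fin M))) := by
    intro n
    induction n with
    | zero => exact fun _ => ⟨fun _ => ∅, by simp, by simp, by simp⟩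
    | succ n ih =>
      intro hn
      obtain ⟨B, h1, h2, h3⟩ := ih (by omega)
      have hR : ((Finset.range n).biUnion B).card ≤ r * (Module.finrank ℝ E + 1) := by
        refine (Finset.card_biUnion_le_card_mul _ _ _ fun k hk => h1 k (by simpa using hk)).trans ?_
        rw [Finset.card_range]
        exact Nat.mul_le_mul_right _ (by omega)
      obtain ⟨A, hAR, hA, hcA⟩ := exists_subset_card_le_mem_convexHull z _ (hc _ hR)
      refine ⟨Function.update B n A, fun k hk => ?_, fun k hk l hl => ?_, fun k hk => ?_⟩
      · rcases Nat.lt_succ_iff_lt_or_eq.1 hk with hk | rfl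
        · rw [Function.update_of_ne hk.ne]; exact h1 k hk
        · rwa [Function.update_self]
      · rw [Function.update_of_ne (by omega : l ≠ n)]
        rcases Nat.lt_succ_iff_lt_or_eq.1 hk with hk | rfl
        · rw [Function.update_of_ne hk.ne]; exact h2 k hk l hl
        · rw [Function.update_self, Finset.disjoint_left]
          intro i hi hiA
          exact hAR hiA (Finset.mem_biUnion.2 ⟨l, Finset.mem_range.2 hl, hi⟩)
      · rcases Nat.lt_succ_iff_lt_or_eq.1 hk with hk | rfl
        · rw [Function.update_of_ne hk.ne]; exact h3 k hk
        · rwa [Function.update_self]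
  obtain ⟨B, -, h2, h3⟩ := key r le_rfl
  refine ⟨fun k => B k, fun k l hkl => ?_, c, Set.mem_iInter.2 fun k => h3 k k.2⟩
  rcases lt_or_gt_of_ne hkl with h | h
  · exact h2 l l.2 k h
  · exact (h2 k k.2 l h).symm

variable (E) in
/-- First selection lemma: for every weighted point set, some point lies in the convex hulls of a
positive proportion of the `M`-tuples of points. -/
theorem exists_mem_convexHull_positive_fraction :
    ∃ M : ℕ, ∃ c : ℝ, 0 < c ∧ ∀ {ι : Type} [Fintype ι] (y : ι → E) (w : ι → ℝ),
      (∀ i, 0 ≤ w i) → 0 < ∑ i, w i →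
      ∃ x : E, ∀ [DecidablePred fun z : Fin M → ι => x ∈ convexHull ℝ (Set.range (y ∘ z))],
        c * (∑ i, w i) ^ M ≤
          ∑ z : Fin M → ι, if x ∈ convexHull ℝ (Set.range (y ∘ z)) then ∏ k, w (z k) else 0 := by
  classical
  let D := Module.finrank ℝ E + 1
  let M := D * (D * D) + 1
  refine ⟨M, 1 / Fintype.card ((Fin D → Finset (Fin M)) × Fin D), ?_, ?_⟩
  · have : Nonempty ((Fin D → Finset (Fin M)) × Fin D) := ⟨(fun _ => ∅, 0)⟩
    have : 0 < Fintype.card ((Fin D → Finset (Fin M)) × Fin D) := Fintype.card_pos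
    positivity
  intro ι _ y w hw hpos
  obtain ⟨A, -, x, hx⟩ := exists_mem_positive_fraction (M := M)
    (fun B f => convexHull ℝ ((y ∘ f) '' (B : Set (Fin M))))
    (fun B f => (((B.finite_toSet).image _).isCompact_convexHull (𝕜 := ℝ)).isClosed)
    (fun B f => convex_convexHull ℝ _)
    (fun B f g h => by
      congr 1
      exact Set.image_congr fun k hk => congrArg y (h k hk))
    (fun f => by
      obtain ⟨B, hB, hn⟩ := exists_disjoint_convexHull_inter D (Nat.lt_succ_self _) (y ∘ f)
      refine ⟨B, fun k => ?_, hB, hn⟩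
      obtain ⟨c, hc⟩ := hn
      have := convexHull_nonempty_iff.1 ⟨c, Set.mem_iInter.1 hc k⟩
      simpa using this) w hw hpos
  refine ⟨x, fun {_} => ?_⟩
  rw [one_div_mul_eq_div]
  refine hx.trans (Finset.sum_le_sum fun z _ => ?_)
  have h4 : 0 ≤ ∏ k, w (z k) := Finset.prod_nonneg fun k _ => hw _
  split_ifs with h5 h6 h6
  · exact le_rfl
  · exact absurd (convexHull_mono (Set.image_subset_range _ _) h5) h6
  · exact h4
  · exact le_rfl

variable (E) in
/-- Weak `ε`-nets of bounded size exist. -/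
theorem exists_weak_net (ε : ℝ) (hε : 0 < ε) :
    ∃ H : ℕ, ∀ {ι : Type} [Fintype ι] (y : ι → E) (w : ι → ℝ), (∀ i, 0 ≤ w i) → ∑ i, w i = 1 →
      ∀ (n : ℕ) (K : Fin n → Set E) [∀ i, DecidablePred fun j => y j ∈ K i],
        (∀ i, Convex ℝ (K i)) → (∀ i, ε ≤ ∑ j, if y j ∈ K i then w j else 0) →
        ∃ F : Finset E, F.card ≤ H ∧ ∀ i, ∃ x ∈ F, x ∈ K i := by
  classical
  obtain ⟨M, c, hc, hsel⟩ := exists_mem_convexHull_positive_fraction E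
  set δ := c * ε ^ M with hδ
  have hδ0 : 0 < δ := by positivity
  refine ⟨⌊1 / δ⌋₊ + 1, fun {ι} _ y w hw hw1 n K _ hconv hK => ?_⟩
  let mass : Finset E → ℝ := fun F => ∑ z : Fin M → ι,
    if ∃ x ∈ F, x ∈ convexHull ℝ (Set.range (y ∘ z)) then ∏ k, w (z k) else 0
  have hW0 : ∀ z : Fin M → ι, 0 ≤ ∏ k, w (z k) := fun z => Finset.prod_nonneg fun k _ => hw _
  have hmass : ∀ F, mass F ≤ 1 := by
    intro F
    rw [← one_pow M, ← hw1, ← sum_prod_comp_eq_pow]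
    refine Finset.sum_le_sum fun z _ => ?_
    split_ifs
    · exact le_rfl
    · exact hW0 z
  have key : ∀ m : ℕ, ∃ F : Finset E, F.card ≤ m ∧
      ((∀ i, ∃ x ∈ F, x ∈ K i) ∨ m * δ ≤ mass F) := by
    intro m
    induction m with
    | zero => exact ⟨∅, le_rfl, Or.inr (by simp [mass])⟩
    | succ m ih =>
      obtain ⟨F, hF, h | h⟩ := ih
      · exact ⟨F, hF.trans (Nat.le_succ m), Or.inl h⟩
      by_cases hall : ∀ i, ∃ x ∈ F, x ∈ K i
      · exact ⟨F, hF.trans (Nat.le_succ m), Or.inl hall⟩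
      push Not at hall
      obtain ⟨i, hi⟩ := hall
      let v : ι → ℝ := fun j => if y j ∈ K i then w j else 0
      have hv0 : ∀ j, 0 ≤ v j := fun j => by
        simp only [v]
        split_ifs
        · exact hw j
        · exact le_rfl
      have hv : ε ≤ ∑ j, v j := hK i
      obtain ⟨x, hx⟩ := hsel y v hv0 (hε.trans_le hv)
      refine ⟨insert x F, (Finset.card_insert_le _ _).trans (by omega), Or.inr ?_⟩
      have h1 : δ ≤ c * (∑ j, v j) ^ M := by
        rw [hδ]
        gcongr
      have h2 : ∀ z : Fin M → ι,
          (if ∃ x ∈ F, x ∈ convexHull ℝ (Set.range (y ∘ z)) then ∏ k, w (z k) else 0) +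
            (if x ∈ convexHull ℝ (Set.range (y ∘ z)) then ∏ k, v (z k) else 0) ≤
          if ∃ x' ∈ insert x F, x' ∈ convexHull ℝ (Set.range (y ∘ z)) then ∏ k, w (z k) else 0 := by
        intro z
        by_cases hz : ∀ k, y (z k) ∈ K i
        · have hsub : convexHull ℝ (Set.range (y ∘ z)) ⊆ K i :=
            convexHull_min (Set.range_subset_iff.2 hz) (hconv i)
          rw [if_neg (fun ⟨x', hx', hx''⟩ => hi x' hx' (hsub hx'')), zero_add]
          by_cases hxz : x ∈ convexHull ℝ (Set.range (y ∘ z))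
          · rw [if_pos hxz, if_pos ⟨x, Finset.mem_insert_self _ _, hxz⟩]
            exact (Finset.prod_congr rfl fun k _ => if_pos (hz k)).le
          · rw [if_neg hxz]
            split_ifs
            · exact hW0 z
            · exact le_rfl
        · push Not at hz
          obtain ⟨k, hk⟩ := hz
          rw [Finset.prod_eq_zero (f := fun k => v (z k)) (Finset.mem_univ k) (if_neg hk),
            ite_self, add_zero]
          by_cases hF' : ∃ x ∈ F, x ∈ convexHull ℝ (Set.range (y ∘ z))
          · obtain ⟨x', hx', hx''⟩ := hF'
            rw [if_pos ⟨x', hx', hx''⟩, if_pos ⟨x', Finset.mem_insert_of_mem hx', hx''⟩]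
          · rw [if_neg hF']
            split_ifs
            · exact hW0 z
            · exact le_rfl
      have h3 := Finset.sum_le_sum fun z (_ : z ∈ Finset.univ) => h2 z
      rw [Finset.sum_add_distrib] at h3
      push_cast
      rw [add_mul, one_mul]
      exact (add_le_add h (h1.trans hx)).trans h3
  obtain ⟨F, hF, h | h⟩ := key (⌊1 / δ⌋₊ + 1)
  · exact ⟨F, hF, h⟩
  · have h1 := Nat.lt_floor_add_one (1 / δ)
    rw [div_lt_iff₀ hδ0] at h1
    push_cast at h
    exact absurd (h.trans (hmass F)) (not_le.2 h1)

/-- The minimax principle for finite matrices. -/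
theorem exists_mem_stdSimplex_forall_ge {ι κ : Type*} [Fintype ι] [Fintype κ] [Nonempty ι]
    [Nonempty κ] (a : ι → κ → ℝ) (β : ℝ)
    (h : ∀ w ∈ stdSimplex ℝ ι, ∃ k, β ≤ ∑ i, w i * a i k) :
    ∃ u ∈ stdSimplex ℝ κ, ∀ i, β ≤ ∑ k, u k * a i k := by
  classical
  let f : (ι → ℝ) → (κ → ℝ) → ℝ := fun w u => ∑ i, ∑ k, w i * u k * a i k
  have hfx : ∀ w, IsLinearMap ℝ (f w) := fun w =>
    ⟨fun u v => by simp only [f, ← Finset.sum_add_distrib, Pi.add_apply, mul_add, add_mul],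
      fun r u => by
        simp only [f, Finset.mul_sum, Pi.smul_apply, smul_eq_mul]
        exact Finset.sum_congr rfl fun i _ => Finset.sum_congr rfl fun k _ => by ring⟩
  have hfy : ∀ u, IsLinearMap ℝ fun w => f w u := fun u =>
    ⟨fun u v => by simp only [f, ← Finset.sum_add_distrib, Pi.add_apply, add_mul],
      fun r u => by
        simp only [f, Finset.mul_sum, Pi.smul_apply, smul_eq_mul]
        exact Finset.sum_congr rfl fun i _ => Finset.sum_congr rfl fun k _ => by ring⟩
  obtain ⟨w, hw, u, hu, hs⟩ := Sion.exists_isSaddlePointOn (f := f)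
    (X := stdSimplex ℝ ι) (Y := stdSimplex ℝ κ)
    ⟨_, single_mem_stdSimplex ℝ (Classical.arbitrary ι)⟩
    (convex_stdSimplex ℝ ι) (isCompact_stdSimplex ℝ ι)
    (fun u _ =>
      (by fun_prop : Continuous fun w => f w u).lowerSemicontinuous.lowerSemicontinuousOn _)
    (fun u _ => ((hfy u).mk' _).convexOn (convex_stdSimplex ℝ ι) |>.quasiconvexOn)
    (convex_stdSimplex ℝ κ)
    ⟨_, single_mem_stdSimplex ℝ (Classical.arbitrary κ)⟩ (isCompact_stdSimplex ℝ κ)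
    (fun w _ =>
      (by fun_prop : Continuous fun u => f w u).upperSemicontinuous.upperSemicontinuousOn _)
    (fun w _ => ((hfx w).mk' _).concaveOn (convex_stdSimplex ℝ κ) |>.quasiconcaveOn)
  refine ⟨u, hu, fun i => ?_⟩
  obtain ⟨k, hk⟩ := h w hw
  have := hs _ (single_mem_stdSimplex ℝ i) _ (single_mem_stdSimplex ℝ k)
  have h1 : f w (Pi.single k 1) = ∑ i, w i * a i k := by
    refine Finset.sum_congr rfl fun i _ => ?_
    rw [Finset.sum_eq_single k] <;> simp +contextual
  have h2 : f (Pi.single i 1) u = ∑ k, u k * a i k := by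
    simp only [f]
    rw [Finset.sum_eq_single i] <;> simp +contextual
  rw [h1, h2] at this
  exact hk.trans this

variable (E) in
/-- The `(p, dim E + 1)`-theorem for finite families of convex sets, in terms of sequences of
indices. -/
theorem exists_piercing_of_forall_tuple (P : ℕ) :
    ∃ H : ℕ, ∀ (n : ℕ) (K : Fin n → Set E), (∀ i, Convex ℝ (K i)) →
      (∀ f : Fin P → Fin n, ∃ g : Fin (Module.finrank ℝ E + 1) ↪ Fin P,
        (⋂ k, K (f (g k))).Nonempty) →
      ∃ F : Finset E, F.card ≤ H ∧ ∀ i, ∃ x ∈ F, x ∈ K i := by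
  classical
  set N := Fintype.card ((Fin (Module.finrank ℝ E + 1) → Finset (Fin P)) ×
    Fin (Module.finrank ℝ E + 1)) with hN
  have hN0 : 0 < N := by
    have : Nonempty ((Fin (Module.finrank ℝ E + 1) → Finset (Fin P)) ×
      Fin (Module.finrank ℝ E + 1)) := ⟨(fun _ => ∅, 0)⟩
    exact Fintype.card_pos
  obtain ⟨H, hH⟩ := exists_weak_net E (1 / (N : ℝ)) (by positivity)
  refine ⟨H, fun n K hK hyp => ?_⟩
  rcases n with _ | n
  · exact ⟨∅, by simp, fun i => i.elim0⟩
  let Y : Finset (Fin (n + 1)) → E := fun J =>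
    if h : (⋂ i ∈ J, K i).Nonempty then h.some else 0
  have hY : ∀ J : Finset (Fin (n + 1)), (⋂ i ∈ J, K i).Nonempty → ∀ i ∈ J, Y J ∈ K i := by
    intro J hJ i hi
    have : Y J = hJ.some := dif_pos hJ
    rw [this]
    exact Set.mem_iInter₂.1 hJ.some_mem i hi
  let K' : Fin (n + 1) → Set E := fun i =>
    convexHull ℝ (Y '' {J | i ∈ J ∧ (⋂ i ∈ J, K i).Nonempty})
  have hK' : ∀ i, K' i ⊆ K i := by
    refine fun i => convexHull_min ?_ (hK i)
    rintro _ ⟨J, ⟨hi, hJ⟩, rfl⟩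
    exact hY J hJ i hi
  have hYK' : ∀ J : Finset (Fin (n + 1)), (⋂ i ∈ J, K i).Nonempty → ∀ i ∈ J, Y J ∈ K' i :=
    fun J hJ i hi => subset_convexHull ℝ _ ⟨J, ⟨hi, hJ⟩, rfl⟩
  have hcl : ∀ i, IsClosed (K' i) := fun i =>
    ((Set.toFinite _).isCompact_convexHull (𝕜 := ℝ)).isClosed
  have hcv : ∀ i, Convex ℝ (K' i) := fun i => convex_convexHull ℝ _
  have hfrac : ∀ w ∈ stdSimplex ℝ (Fin (n + 1)), ∃ J : Finset (Fin (n + 1)),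
      1 / (N : ℝ) ≤ ∑ i, w i * if Y J ∈ K' i then 1 else 0 := by
    rintro w ⟨hw0, hw1⟩
    obtain ⟨A, ⟨k₀, hk₀⟩, x, hx⟩ := exists_mem_positive_fraction (E := E) (M := P)
      (fun B f => ⋂ k ∈ B, K' (f k))
      (fun B f => isClosed_biInter fun k _ => hcl _)
      (fun B f => convex_iInter₂ fun k _ => hcv _)
      (fun B f g h => Set.iInter₂_congr fun k hk => by rw [h k hk])
      (fun f => by
        obtain ⟨g, hg⟩ := hyp f
        refine ⟨fun k => {g k}, fun k => Finset.singleton_nonempty _, fun k l hkl => ?_, ?_⟩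
        · exact Finset.disjoint_singleton.2 (g.injective.ne hkl)
        · let J := Finset.univ.image fun k => f (g k)
          have hJ : (⋂ i ∈ J, K i).Nonempty := by
            obtain ⟨x, hx⟩ := hg
            refine ⟨x, Set.mem_iInter₂.2 fun i hi => ?_⟩
            obtain ⟨k, -, rfl⟩ := Finset.mem_image.1 hi
            exact Set.mem_iInter.1 hx k
          refine ⟨Y J, Set.mem_iInter.2 fun k => ?_⟩
          simpa using hYK' J hJ _ (Finset.mem_image_of_mem _ (Finset.mem_univ k)))
      w hw0 (by rw [hw1]; exact one_pos)
    rw [hw1, one_pow, ← hN] at hx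
    let J : Finset (Fin (n + 1)) := Finset.univ.filter fun i => x ∈ K' i
    have hJ : (⋂ i ∈ J, K i).Nonempty :=
      ⟨x, Set.mem_iInter₂.2 fun i hi => hK' i (Finset.mem_filter.1 hi).2⟩
    refine ⟨J, hx.trans ?_⟩
    have hmarg : ∑ z : Fin P → Fin (n + 1), (if x ∈ K' (z k₀) then ∏ k, w (z k) else 0) =
        ∑ i, if x ∈ K' i then w i else 0 := by
      have h1 : ∀ z : Fin P → Fin (n + 1), (if x ∈ K' (z k₀) then ∏ k, w (z k) else 0) =
          ∏ k, if k = k₀ then (if x ∈ K' (z k) then w (z k) else 0) else w (z k) := by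
        intro z
        split_ifs with h
        · refine Finset.prod_congr rfl fun k _ => ?_
          split_ifs with h2 h3
          · rfl
          · exact absurd (h2 ▸ h) h3
          · rfl
        · exact (Finset.prod_eq_zero (Finset.mem_univ k₀) (by simp [h])).symm
      simp only [h1]
      rw [← Fintype.piFinset_univ, Finset.sum_prod_piFinset Finset.univ
        (fun k i => if k = k₀ then (if x ∈ K' i then w i else 0) else w i),
        Finset.prod_eq_single k₀]
      · simp
      · intro k _ hk
        simp [hk, hw1]
      · simp
    calc _ ≤ ∑ z : Fin P → Fin (n + 1), (if x ∈ K' (z k₀) then ∏ k, w (z k) else 0) := by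
          refine Finset.sum_le_sum fun z _ => ?_
          have h4 : 0 ≤ ∏ k, w (z k) := Finset.prod_nonneg fun k _ => hw0 _
          split_ifs with h5 h6 h6
          · exact le_rfl
          · exact absurd (Set.mem_iInter₂.1 h5 k₀ hk₀) h6
          · exact h4
          · exact le_rfl
      _ = ∑ i, if x ∈ K' i then w i else 0 := hmarg
      _ ≤ _ := by
          refine Finset.sum_le_sum fun i _ => ?_
          split_ifs with h1 h2 h2
          · simp
          · exact absurd (hYK' J hJ i (Finset.mem_filter.2 ⟨Finset.mem_univ i, h1⟩)) h2
          · simpa using hw0 i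
          · simp
  obtain ⟨u, ⟨hu0, hu1⟩, hu⟩ := exists_mem_stdSimplex_forall_ge
    (fun (i : Fin (n + 1)) (J : Finset (Fin (n + 1))) => if Y J ∈ K' i then (1 : ℝ) else 0)
    _ hfrac
  obtain ⟨F, hF, hFK⟩ := hH Y u hu0 hu1 (n + 1) K' hcv fun i => by simpa using hu i
  exact ⟨F, hF, fun i => (hFK i).imp fun x hx => ⟨hx.1, hK' i hx.2⟩⟩

end FiniteDimensional

section Ellipsoids

/-- The index set of the parameters of an ellipsoid: the entries of a lower triangular matrix and
the coordinates of the centre. -/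
abbrev EllipsoidIndex (d : ℕ) : Type := {q : Fin d × Fin d // q.2 ≤ q.1} ⊕ Fin d

theorem finrank_ellipsoidIndex (d : ℕ) :
    Module.finrank ℝ (EuclideanSpace ℝ (EllipsoidIndex d)) = d * (d + 3) / 2 := by
  have h1 : ∀ d : ℕ, (∑ i ∈ Finset.range d, (i + 1)) * 2 = d * (d + 1) := by
    intro d
    induction d with
    | zero => simp
    | succ d ih =>
      rw [Finset.sum_range_succ, add_mul, ih]
      ring
  have h2 : (Finset.univ.filter fun q : Fin d × Fin d => q.2 ≤ q.1).card =
      ∑ i ∈ Finset.range d, (i + 1) := by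
    rw [Finset.card_filter, ← Finset.univ_product_univ, Finset.sum_product, Finset.sum_range]
    refine Finset.sum_congr rfl fun i _ => ?_
    rw [← Finset.card_filter, ← Fin.card_Iic]
    congr 1
    ext j
    simp
  have h3 : d * (d + 3) = d * (d + 1) + d * 2 := by ring
  rw [finrank_euclideanSpace, Fintype.card_sum, Fintype.card_fin, Fintype.card_subtype, h2]
  have := h1 d
  omega

variable {d : ℕ}

/-- The diagonal position `(i, i)`. -/
abbrev diagIndex (i : Fin d) : EllipsoidIndex d := Sum.inl ⟨(i, i), le_rfl⟩

/-- The lower triangular matrix with prescribed entries. -/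
def lowerMatrix (v : EuclideanSpace ℝ (EllipsoidIndex d)) : Matrix (Fin d) (Fin d) ℝ :=
  Matrix.of fun i j => if h : j ≤ i then v (Sum.inl ⟨(i, j), h⟩) else 0

/-- The vector of the last `d` parameters. -/
noncomputable def centre (v : EuclideanSpace ℝ (EllipsoidIndex d)) : EuclideanSpace ℝ (Fin d) :=
  WithLp.toLp 2 fun i => v (Sum.inr i)

/-- The affine map with prescribed lower triangular matrix and constant term. -/
noncomputable def lowerMap (v : EuclideanSpace ℝ (EllipsoidIndex d))
    (b : EuclideanSpace ℝ (Fin d)) : EuclideanSpace ℝ (Fin d) :=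
  centre v + Matrix.toEuclideanLin (lowerMatrix v) b

theorem lowerMap_combination (r s : ℝ) (v v' : EuclideanSpace ℝ (EllipsoidIndex d))
    (b : EuclideanSpace ℝ (Fin d)) :
    lowerMap (r • v + s • v') b = r • lowerMap v b + s • lowerMap v' b := by
  have h1 : lowerMatrix (r • v + s • v') = r • lowerMatrix v + s • lowerMatrix v' := by
    ext i j
    by_cases h : j ≤ i <;> simp [lowerMatrix, h]
  have h2 : centre (r • v + s • v') = r • centre v + s • centre v' := by
    ext i
    simp [centre]
  simp only [lowerMap, h1, h2, map_add, map_smul, LinearMap.add_apply, LinearMap.smul_apply,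
    smul_add]
  abel

theorem det_lowerMap (v : EuclideanSpace ℝ (EllipsoidIndex d)) :
    LinearMap.det (Matrix.toEuclideanLin (lowerMatrix v)) = ∏ i, v (diagIndex i) := by
  rw [Matrix.toEuclideanLin, Matrix.toLpLin_eq_toLin, LinearMap.det_toLin,
    Matrix.det_of_isLowerTriangular]
  · exact Finset.prod_congr rfl fun i _ => by simp [lowerMatrix]
  · intro i j hij
    have hij' : i < j := hij
    simp [lowerMatrix, hij'.not_ge]

theorem volume_lowerMap_image (v : EuclideanSpace ℝ (EllipsoidIndex d))
    (s : Set (EuclideanSpace ℝ (Fin d))) :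
    volume (lowerMap v '' s) = ENNReal.ofReal |∏ i, v (diagIndex i)| * volume s := by
  have : lowerMap v '' s = (fun x => centre v + x) ''
      (Matrix.toEuclideanLin (lowerMatrix v) '' s) := by
    rw [Set.image_image]
    rfl
  rw [this, Set.image_add_left, measure_preimage_add, Measure.addHaar_image_linearMap, det_lowerMap]

/-- The volume of the unit ball. -/
noncomputable def ballVolume (d : ℕ) : ℝ :=
  (volume (Metric.closedBall (0 : EuclideanSpace ℝ (Fin d)) 1)).toReal

theorem ballVolume_pos (d : ℕ) : 0 < ballVolume d :=
  ENNReal.toReal_pos (Metric.measure_closedBall_pos volume _ one_pos).ne'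
    (isCompact_closedBall _ _).measure_lt_top.ne

theorem volume_lowerMap_closedBall (v : EuclideanSpace ℝ (EllipsoidIndex d))
    (hv : ∀ i, 0 < v (diagIndex i)) :
    volume (lowerMap v '' Metric.closedBall 0 1) =
      ENNReal.ofReal ((∏ i, v (diagIndex i)) * ballVolume d) := by
  have h : 0 ≤ ∏ i, v (diagIndex i) := Finset.prod_nonneg fun i _ => (hv i).le
  rw [volume_lowerMap_image, abs_of_nonneg h, ENNReal.ofReal_mul h, ballVolume,
    ENNReal.ofReal_toReal (isCompact_closedBall _ _).measure_lt_top.ne]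

/-- Parameters of ellipsoids with volume at least one. -/
def largeEllipsoids (d : ℕ) : Set (EuclideanSpace ℝ (EllipsoidIndex d)) :=
  {v | (∀ i, 0 < v (diagIndex i)) ∧ 1 ≤ (∏ i, v (diagIndex i)) * ballVolume d}

theorem convex_largeEllipsoids (d : ℕ) : Convex ℝ (largeEllipsoids d) := by
  rintro v ⟨hv, hv1⟩ v' ⟨hv', hv1'⟩ r s hr hs hrs
  have hpos : ∀ i, 0 < (r • v + s • v') (diagIndex i) := by
    intro i
    exact convex_Ioi (0 : ℝ) (hv i) (hv' i) hr hs hrs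
  refine ⟨hpos, ?_⟩
  have hb := ballVolume_pos d
  have hp : 0 < ∏ i, v (diagIndex i) := Finset.prod_pos fun i _ => hv i
  have hp' : 0 < ∏ i, v' (diagIndex i) := Finset.prod_pos fun i _ => hv' i
  have h1 : (∏ i, v (diagIndex i)) ^ r * (∏ i, v' (diagIndex i)) ^ s ≤
      ∏ i, (r • v + s • v') (diagIndex i) := by
    rw [← Real.finsetProd_rpow _ _ (fun i _ => (hv i).le),
      ← Real.finsetProd_rpow _ _ (fun i _ => (hv' i).le), ← Finset.prod_mul_distrib]
    refine Finset.prod_le_prod (fun i _ => ?_) fun i _ => ?_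
    · exact mul_nonneg (Real.rpow_nonneg (hv i).le _) (Real.rpow_nonneg (hv' i).le _)
    · exact Real.geom_mean_le_arith_mean2_weighted hr hs (hv i).le (hv' i).le hrs
  calc (1 : ℝ) ≤ ((∏ i, v (diagIndex i)) * ballVolume d) ^ r *
        ((∏ i, v' (diagIndex i)) * ballVolume d) ^ s :=
        one_le_mul_of_one_le_of_one_le (Real.one_le_rpow hv1 hr) (Real.one_le_rpow hv1' hs)
    _ = ((∏ i, v (diagIndex i)) ^ r * (∏ i, v' (diagIndex i)) ^ s) * ballVolume d := by
        rw [Real.mul_rpow hp.le hb.le, Real.mul_rpow hp'.le hb.le, mul_mul_mul_comm,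
          ← Real.rpow_add hb, hrs, Real.rpow_one]
    _ ≤ _ := mul_le_mul_of_nonneg_right h1 hb.le

/-- Parameters of affine maps sending the unit ball into `C`. -/
def innerEllipsoids (C : Set (EuclideanSpace ℝ (Fin d))) :
    Set (EuclideanSpace ℝ (EllipsoidIndex d)) :=
  {v | lowerMap v '' Metric.closedBall 0 1 ⊆ C}

theorem convex_innerEllipsoids {C : Set (EuclideanSpace ℝ (Fin d))} (hC : Convex ℝ C) :
    Convex ℝ (innerEllipsoids C) := by
  rintro v hv v' hv' r s hr hs hrs _ ⟨b, hb, rfl⟩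
  rw [lowerMap_combination]
  exact hC (hv ⟨b, hb, rfl⟩) (hv' ⟨b, hb, rfl⟩) hr hs hrs

/-- An ellipsoid of volume at least one contains one of volume exactly one. -/
theorem exists_ellipsoid_subset_lowerMap_image (hd : d ≠ 0)
    {v : EuclideanSpace ℝ (EllipsoidIndex d)} (hv : v ∈ largeEllipsoids d) :
    ∃ E, IsEllipsoid E ∧ volume E = 1 ∧ E ⊆ lowerMap v '' Metric.closedBall 0 1 := by
  obtain ⟨hv0, hv1⟩ := hv
  set q := (∏ i, v (diagIndex i)) * ballVolume d with hq
  have hq0 : 0 < q := one_pos.trans_le hv1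
  set s : ℝ := (q⁻¹) ^ ((d : ℝ)⁻¹) with hs
  have hs0 : 0 < s := Real.rpow_pos_of_pos (inv_pos.2 hq0) _
  have hs1 : s ≤ 1 := Real.rpow_le_one (inv_pos.2 hq0).le (inv_le_one_of_one_le₀ hv1)
    (by positivity)
  have hsd : s ^ d = q⁻¹ := Real.rpow_inv_natCast_pow (inv_pos.2 hq0).le hd
  let v' : EuclideanSpace ℝ (EllipsoidIndex d) :=
    WithLp.toLp 2 (Sum.elim (fun k => s * v (Sum.inl k)) fun i => v (Sum.inr i))
  have hv'd : ∀ i, v' (diagIndex i) = s * v (diagIndex i) := fun i => rfl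
  have hv'0 : ∀ i, 0 < v' (diagIndex i) := fun i => mul_pos hs0 (hv0 i)
  have hmap : ∀ b, lowerMap v' b = lowerMap v (s • b) := by
    intro b
    have h1 : lowerMatrix v' = s • lowerMatrix v := by
      ext i j
      by_cases h : j ≤ i <;> simp [lowerMatrix, h, v']
    have h2 : centre v' = centre v := by
      ext i
      simp [centre, v']
    simp only [lowerMap, h1, h2, map_smul, LinearMap.smul_apply]
  have hprod : (∏ i, v' (diagIndex i)) * ballVolume d = 1 := by
    simp only [hv'd]
    rw [Finset.prod_mul_distrib, Finset.prod_const, Finset.card_univ, Fintype.card_fin, hsd,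
      mul_assoc, ← hq, inv_mul_cancel₀ hq0.ne']
  refine ⟨lowerMap v' '' Metric.closedBall 0 1, ?_, ?_, ?_⟩
  · have hdet : LinearMap.det (Matrix.toEuclideanLin (lowerMatrix v')) ≠ 0 := by
      rw [det_lowerMap]
      exact (Finset.prod_pos fun i _ => hv'0 i).ne'
    exact ⟨((Matrix.toEuclideanLin (lowerMatrix v')).equivOfDetNeZero hdet).toAffineEquiv.trans
      (AffineEquiv.constVAdd ℝ _ (centre v')), rfl⟩
  · rw [volume_lowerMap_closedBall v' hv'0, hprod, ENNReal.ofReal_one]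
  · rintro _ ⟨b, hb, rfl⟩
    refine ⟨s • b, ?_, (hmap b).symm⟩
    rw [mem_closedBall_zero_iff] at hb ⊢
    rw [norm_smul, Real.norm_of_nonneg hs0.le]
    exact mul_le_one₀ hs1 (norm_nonneg b) hb

/-- Every ellipsoid is the image of the unit ball under an affine map whose linear part is lower
triangular with positive diagonal. -/
theorem IsEllipsoid.exists_lowerMap {E : Set (EuclideanSpace ℝ (Fin d))} (hE : IsEllipsoid E) :
    ∃ v : EuclideanSpace ℝ (EllipsoidIndex d), (∀ i, 0 < v (diagIndex i)) ∧
      lowerMap v '' Metric.closedBall 0 1 = E := by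
  obtain ⟨L, rfl⟩ := hE
  let A : EuclideanSpace ℝ (Fin d) →ₗ[ℝ] EuclideanSpace ℝ (Fin d) := L.linear.toLinearMap
  let e := EuclideanSpace.basisFun (Fin d) ℝ
  let f : Fin d → EuclideanSpace ℝ (Fin d) := fun i => A.adjoint (e i)
  have hA : LinearMap.ker A.adjoint = ⊥ := by
    rw [LinearMap.ker_eq_bot']
    intro x hx
    obtain ⟨y, hy⟩ := L.linear.surjective x
    have h1 : inner ℝ x (A y) = 0 := by
      rw [← LinearMap.adjoint_inner_left, hx, inner_zero_left]
    have h2 : A y = x := hy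
    rwa [h2, inner_self_eq_zero] at h1
  have hf : LinearIndependent ℝ f := by
    have := e.toBasis.linearIndependent.map' A.adjoint hA
    rwa [OrthonormalBasis.coe_toBasis] at this
  have hcard : Module.finrank ℝ (EuclideanSpace ℝ (Fin d)) = Fintype.card (Fin d) :=
    finrank_euclideanSpace
  let u := InnerProductSpace.gramSchmidtOrthonormalBasis hcard f
  have hlow : ∀ i j, i < j → inner ℝ (u j) (f i) = 0 := fun i j hij =>
    InnerProductSpace.gramSchmidtOrthonormalBasis_inv_triangular hcard f hij
  have hdiag : ∀ i, 0 < inner ℝ (u i) (f i) := by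
    intro i
    have hg := InnerProductSpace.gramSchmidt_ne_zero (𝕜 := ℝ) i hf
    have hn : InnerProductSpace.gramSchmidtNormed ℝ f i ≠ 0 := by
      rw [← norm_ne_zero_iff, InnerProductSpace.gramSchmidtNormed_unit_length i hf]
      exact one_ne_zero
    have h1 : inner ℝ (InnerProductSpace.gramSchmidt ℝ f i) (f i) =
        ‖InnerProductSpace.gramSchmidt ℝ f i‖ ^ 2 := by
      conv_lhs => rw [InnerProductSpace.gramSchmidt_def'' ℝ f i]
      rw [inner_add_right, real_inner_self_eq_norm_sq, inner_sum, Finset.sum_eq_zero, add_zero]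
      intro j hj
      rw [inner_smul_right, InnerProductSpace.gramSchmidt_orthogonal ℝ f
        (Finset.mem_Iio.1 hj).ne', mul_zero]
    have hu : u i = _ := InnerProductSpace.gramSchmidtOrthonormalBasis_apply hcard hn
    have hg' := norm_pos_iff.2 hg
    rw [hu, InnerProductSpace.gramSchmidtNormed, real_inner_smul_left, h1]
    exact mul_pos (inv_pos.2 hg') (pow_pos hg' 2)
  let v : EuclideanSpace ℝ (EllipsoidIndex d) :=
    WithLp.toLp 2 (Sum.elim (fun q => inner ℝ (u q.1.2) (f q.1.1)) fun i => L 0 i)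
  refine ⟨v, hdiag, ?_⟩
  have hM : ∀ i j, lowerMatrix v i j = A (u j) i := by
    intro i j
    have h1 : A (u j) i = inner ℝ (u j) (f i) := by
      rw [LinearMap.adjoint_inner_right, real_inner_comm, EuclideanSpace.basisFun_inner]
    rw [h1]
    by_cases h : j ≤ i
    · simp [lowerMatrix, h, v]
    · simp [lowerMatrix, h, hlow i j (not_le.1 h)]
  have hmap : ∀ b, lowerMap v b = L (u.repr.symm b) := by
    intro b
    have h1 : L (u.repr.symm b) = A (u.repr.symm b) + L 0 := by
      have := L.map_vadd 0 (u.repr.symm b)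
      rwa [vadd_eq_add, add_zero, vadd_eq_add] at this
    rw [h1, ← OrthonormalBasis.sum_repr_symm, map_sum, add_comm]
    ext i
    simp [lowerMap, centre, Matrix.toLpLin_apply, Matrix.mulVec, dotProduct, hM, v, mul_comm]
  have himage : u.repr.symm '' Metric.closedBall 0 1 = Metric.closedBall 0 1 := by
    rw [LinearIsometryEquiv.image_closedBall, map_zero]
  calc lowerMap v '' Metric.closedBall 0 1 = L '' (u.repr.symm '' Metric.closedBall 0 1) := by
        rw [Set.image_image]
        exact Set.image_congr fun b _ => hmap b
    _ = _ := by rw [himage]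

end Ellipsoids

section Helly

variable {d n : ℕ}

/-- The members of `U` have a common inscribed ellipsoid of volume at least one. -/
def HaveCommonEllipsoid (C : Fin n → Set (EuclideanSpace ℝ (Fin d))) (U : Finset (Fin n)) : Prop :=
  ∃ v ∈ largeEllipsoids d, ∀ i ∈ U, v ∈ innerEllipsoids (C i)

theorem IsEllipsoid.haveCommonEllipsoid {E : Set (EuclideanSpace ℝ (Fin d))} (hE : IsEllipsoid E)
    (hvol : volume E = 1) {C : Fin n → Set (EuclideanSpace ℝ (Fin d))} {U : Finset (Fin n)}
    (hU : ∀ i ∈ U, E ⊆ C i) : HaveCommonEllipsoid C U := by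
  obtain ⟨v, hv, rfl⟩ := hE.exists_lowerMap
  refine ⟨v, ⟨hv, ?_⟩, hU⟩
  rw [volume_lowerMap_closedBall v hv] at hvol
  exact (ENNReal.ofReal_eq_one.1 hvol).ge

/-- A Helly-type theorem for inscribed ellipsoids: it suffices to check subfamilies of size
`d * (d + 3) / 2` in a family with one more member. -/
theorem haveCommonEllipsoid_of_subsets (hd : 1 ≤ d) {C : Fin n → Set (EuclideanSpace ℝ (Fin d))}
    (hC : ∀ i, Convex ℝ (C i)) {S : Finset (Fin n)} (hS : S.card = d * (d + 3) / 2 + 1)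
    (h : ∀ U ⊆ S, U.card = d * (d + 3) / 2 → HaveCommonEllipsoid C U) :
    HaveCommonEllipsoid C S := by
  classical
  have hdD : d + 1 ≤ d * (d + 3) / 2 := by
    rw [Nat.le_div_iff_mul_le two_pos]
    nlinarith
  have hpoint : (⋂ i ∈ S, C i).Nonempty := by
    refine Convex.helly_theorem (𝕜 := ℝ) ?_ (fun i _ => hC i) fun I hI hIcard => ?_
    · rw [finrank_euclideanSpace_fin, hS]
      omega
    · rw [finrank_euclideanSpace_fin] at hIcard
      obtain ⟨J, hIJ, hJS, hJ⟩ := Finset.exists_subsuperset_card_eq hI (hIcard.trans_le hdD)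
        (by omega)
      obtain ⟨v, -, hv⟩ := h J hJS hJ
      exact ⟨lowerMap v 0, Set.mem_iInter₂.2 fun i hi =>
        hv i (hIJ hi) ⟨0, Metric.mem_closedBall_self zero_le_one, rfl⟩⟩
  let F : Option (Fin n) → Set (EuclideanSpace ℝ (EllipsoidIndex d)) :=
    fun o => o.elim (largeEllipsoids d) fun i => innerEllipsoids (C i)
  have hF : (⋂ o ∈ S.insertNone, F o).Nonempty := by
    refine Convex.helly_theorem (𝕜 := ℝ) ?_ ?_ fun I hI hIcard => ?_
    · rw [finrank_ellipsoidIndex, Finset.card_insertNone, hS]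
      omega
    · rintro (_ | i) -
      · exact convex_largeEllipsoids d
      · exact convex_innerEllipsoids (hC i)
    · rw [finrank_ellipsoidIndex] at hIcard
      have hsub : I.eraseNone ⊆ S := by
        intro i hi
        exact Finset.some_mem_insertNone.1 (hI (Finset.mem_eraseNone.1 hi))
      by_cases hnone : none ∈ I
      · have hcard : I.eraseNone.card = d * (d + 3) / 2 := by
          rw [Finset.card_eraseNone_of_mem hnone, hIcard, Nat.add_sub_cancel]
        obtain ⟨v, hv1, hv2⟩ := h _ hsub hcard
        refine ⟨v, Set.mem_iInter₂.2 ?_⟩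
        rintro (_ | i) hi
        · exact hv1
        · exact hv2 i (Finset.mem_eraseNone.2 hi)
      · obtain ⟨a, ha⟩ := hpoint
        let v : EuclideanSpace ℝ (EllipsoidIndex d) :=
          WithLp.toLp 2 (Sum.elim (fun _ => 0) fun i => a i)
        have hv : ∀ b, lowerMap v b = a := by
          intro b
          have h1 : lowerMatrix v = 0 := by
            ext i j
            simp [lowerMatrix, v]
          have h2 : centre v = a := rfl
          rw [lowerMap, h1, h2, map_zero, LinearMap.zero_apply, add_zero]
        refine ⟨v, Set.mem_iInter₂.2 ?_⟩
        rintro (_ | i) hi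
        · exact absurd hi hnone
        · rintro _ ⟨b, -, rfl⟩
          rw [hv]
          exact Set.mem_iInter₂.1 ha i (hsub (Finset.mem_eraseNone.2 hi))
  obtain ⟨v, hv⟩ := hF
  rw [Set.mem_iInter₂] at hv
  exact ⟨v, hv none Finset.none_mem_insertNone, fun i hi =>
    hv (some i) (Finset.some_mem_insertNone.2 hi)⟩

/-- If `f` sends at least `m` indices into a family with a common ellipsoid, then the parameter
sets of some `m` of these indices have a common point. -/
theorem HaveCommonEllipsoid.exists_embedding {C : Fin n → Set (EuclideanSpace ℝ (Fin d))}
    {U : Finset (Fin n)} (hU : HaveCommonEllipsoid C U) {P m : ℕ} {f : Fin P → Fin n}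
    {J : Finset (Fin P)} (hJ : m ≤ J.card) (hf : ∀ j ∈ J, f j ∈ U) :
    ∃ g : Fin m ↪ Fin P,
      (⋂ k, largeEllipsoids d ∩ innerEllipsoids (C (f (g k)))).Nonempty := by
  obtain ⟨v, hv1, hv2⟩ := hU
  obtain ⟨J', hJ', hcard⟩ := Finset.exists_subset_card_eq hJ
  refine ⟨(J'.orderEmbOfFin hcard).toEmbedding, v, Set.mem_iInter.2 fun k =>
    ⟨hv1, hv2 _ (hf _ (hJ' (J'.orderEmbOfFin_mem hcard k)))⟩⟩

end Helly

/-- Quantitative (p,q)-Theorem with a large lower bound on p. -/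
theorem quantitative_pq_large_p
    (d : ℕ) (hd : 1 ≤ d) (p : ℕ) (hp : d * (d + 3) / 2 ≤ p) :
    ∃ H : ℕ,
      ∀ n : ℕ, ∀ C : Fin n → Set (EuclideanSpace ℝ (Fin d)),
        (∀ i, Convex ℝ (C i)) →
        (∀ i, ∃ E, IsEllipsoid E ∧ volume E = 1 ∧ E ⊆ C i) →
        (∀ S : Finset (Fin n), S.card = p →
          ∃ T ⊆ S, T.card = d * (d + 3) / 2 ∧
            ∃ E, IsEllipsoid E ∧ volume E = 1 ∧ E ⊆ ⋂ i ∈ T, C i) →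
        ∃ T : Finset (Set (EuclideanSpace ℝ (Fin d))),
          T.card ≤ H ∧
          (∀ E ∈ T, IsEllipsoid E ∧ volume E = 1) ∧
          ∀ i, ∃ E ∈ T, E ⊆ C i := by
  classical
  obtain ⟨N, hN⟩ := exists_ramsey_number (d * (d + 3) / 2) p (d * (d + 3) / 2 + 1)
  obtain ⟨H, hH⟩ := exists_piercing_of_forall_tuple (EuclideanSpace ℝ (EllipsoidIndex d))
    (N * (d * (d + 3) / 2) + 1)
  refine ⟨H, fun n C hC hone hpq => ?_⟩
  obtain ⟨F, hFcard, hF⟩ := hH n (fun i => largeEllipsoids d ∩ innerEllipsoids (C i))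
    (fun i => (convex_largeEllipsoids d).inter (convex_innerEllipsoids (hC i))) (by
      intro f
      rw [finrank_ellipsoidIndex]
      rcases le_or_gt N (Finset.univ.image f).card with hlarge | hsmall
      · rcases hN n _ hlarge (HaveCommonEllipsoid C) with ⟨S, -, hS, hbad⟩ | ⟨S, hSf, hS, hgood⟩
        · obtain ⟨T, hTS, hT, E, hE, hvol, hET⟩ := hpq S hS
          exact absurd (hE.haveCommonEllipsoid hvol fun i hi =>
            hET.trans (Set.biInter_subset_of_mem hi)) (hbad T hTS hT)
        · refine (haveCommonEllipsoid_of_subsets hd hC hS hgood).exists_embedding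
            (J := Finset.univ.filter fun j => f j ∈ S) ?_ fun j hj => (Finset.mem_filter.1 hj).2
          rw [← hS]
          refine Finset.card_le_card_of_surjOn f fun i hi => ?_
          obtain ⟨j, -, rfl⟩ := Finset.mem_image.1 (hSf hi)
          exact ⟨j, by simpa using hi, rfl⟩
      · obtain ⟨i, -, hi⟩ := Finset.exists_lt_card_fiber_of_mul_lt_card_of_maps_to
          (s := Finset.univ) (t := Finset.univ.image f) (f := f) (n := d * (d + 3) / 2)
          (fun j hj => Finset.mem_image_of_mem f hj) (by
            rw [Finset.card_univ, Fintype.card_fin]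
            exact Nat.lt_succ_of_le (Nat.mul_le_mul_right _ hsmall.le))
        obtain ⟨E, hE, hvol, hEC⟩ := hone i
        have : HaveCommonEllipsoid C {i} := hE.haveCommonEllipsoid hvol fun j hj => by
          rwa [Finset.mem_singleton.1 hj]
        exact this.exists_embedding hi fun j hj => by simpa using hj)
  choose! e he using fun (v : EuclideanSpace ℝ (EllipsoidIndex d)) (hv : v ∈ largeEllipsoids d) =>
    exists_ellipsoid_subset_lowerMap_image (Nat.one_le_iff_ne_zero.1 hd) hv
  refine ⟨(F.filter (· ∈ largeEllipsoids d)).image e,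
    (Finset.card_image_le.trans (Finset.card_filter_le _ _)).trans hFcard, ?_, fun i => ?_⟩
  · intro E hE
    obtain ⟨v, hv, rfl⟩ := Finset.mem_image.1 hE
    have := he v (Finset.mem_filter.1 hv).2
    exact ⟨this.1, this.2.1⟩
  · obtain ⟨v, hvF, hv1, hv2⟩ := hF i
    exact ⟨e v, Finset.mem_image_of_mem e (Finset.mem_filter.2 ⟨hvF, hv1⟩),
      (he v hv1).2.2.trans hv2⟩
end

section
/- Quantitative Helly Theorem in terms of ellipsoids: There is an absolute constant c > 0 such that the following holds for every dimension d ≥ 1. Let C₁, …, Cₙ be convex sets in ℝ^d (n ≥ 2d) such that the intersection of any 2d of them contains an ellipsoid of volume at least one. Then the intersection ⋂_{i=1}^n Cᵢ contains an ellipsoid of volume at least c^d · d^(−3d/2). -/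
open MeasureTheory

open Module
open scoped RealInnerProductSpace

theorem Convex.exists_minkowski_center {E : Type*} [NormedAddCommGroup E] [NormedSpace ℝ E]
    [FiniteDimensional ℝ E] {K : Set E} (hc : Convex ℝ K) (hK : IsCompact K) (hne : K.Nonempty)
    {d : ℕ} (hd : finrank ℝ E = d) (hpos : 0 < d) :
    ∃ o ∈ K, ∀ x ∈ K, o - (d : ℝ)⁻¹ • (x - o) ∈ K := by
  classical
  have hd0 : (0 : ℝ) < d := by exact_mod_cast hpos
  let F : K → Set E := fun x => (fun y => ((d : ℝ) + 1)⁻¹ • ((x : E) + (d : ℝ) • y)) '' K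
  have key : (⋂ x, F x).Nonempty := by
    apply Convex.helly_theorem_compact' (𝕜 := ℝ)
    · intro x
      have : F x = (fun z => (((d : ℝ) + 1)⁻¹ • (x : E)) + z) ''
          ((fun y => (((d : ℝ) + 1)⁻¹ * d) • y) '' K) := by
        rw [Set.image_image]
        simp only [F, smul_add, smul_smul]
      rw [this]
      exact (hc.smul _).translate _
    · intro x
      exact hK.image (by fun_prop)
    · intro I hI
      rcases I.eq_empty_or_nonempty with rfl | hIne
      · simp
      rw [hd] at hI
      have hk : (0 : ℝ) < I.card := by exact_mod_cast hIne.card_pos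
      have hI' : (I.card : ℝ) ≤ d + 1 := by exact_mod_cast hI
      refine ⟨(I.card : ℝ)⁻¹ • ∑ z ∈ I, (z : E), ?_⟩
      simp only [Set.mem_iInter]
      intro x hx
      refine ⟨∑ z ∈ I, (((d + 1) / I.card - if z = x then 1 else 0) / d : ℝ) • (z : E), ?_, ?_⟩
      · apply hc.sum_mem
        · intro z _
          have : (1 : ℝ) ≤ (d + 1) / I.card := by rwa [le_div_iff₀ hk, one_mul]
          apply div_nonneg _ hd0.le
          split_ifs <;> linarith
        · rw [← Finset.sum_div, Finset.sum_sub_distrib, Finset.sum_ite_eq' I x, if_pos hx]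
          simp only [Finset.sum_const, nsmul_eq_mul]
          field_simp
          ring
        · intro z _
          exact z.2
      · have : ∑ z ∈ I, (((d + 1) / I.card - if z = x then 1 else 0) / d : ℝ) • (z : E)
            = ((d + 1) / I.card / d : ℝ) • ∑ z ∈ I, (z : E) - (d : ℝ)⁻¹ • (x : E) := by
          simp only [sub_div, sub_smul, Finset.sum_sub_distrib, Finset.smul_sum]
          congr 1
          rw [Finset.sum_eq_single x]
          · simp
          · intro z _ hz
            simp [hz]
          · exact fun h => absurd hx h
        simp only [this]
        match_scalars <;> field_simp
        ring
  obtain ⟨o, ho⟩ := key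
  simp only [Set.mem_iInter] at ho
  refine ⟨o, ?_, ?_⟩
  · obtain ⟨x, hx⟩ := hne
    obtain ⟨y, hy, rfl⟩ := ho ⟨x, hx⟩
    have := hc hx hy (a := ((d : ℝ) + 1)⁻¹) (b := ((d : ℝ) + 1)⁻¹ * d) (by positivity)
      (by positivity) (by field_simp; ring)
    simpa only [smul_add, smul_smul] using this
  · intro x hx
    obtain ⟨y, hy, hxy⟩ := ho ⟨x, hx⟩
    convert hy using 1
    rw [← hxy]
    match_scalars <;> field_simp <;> ring

theorem Convex.mem_interior_of_sub_smul_mem {E : Type*} [NormedAddCommGroup E] [NormedSpace ℝ E]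
    {K : Set E} (hc : Convex ℝ K) (hne : (interior K).Nonempty) {o : E} {t : ℝ} (ht : 0 < t)
    (ho : ∀ x ∈ K, o - t • (x - o) ∈ K) : o ∈ interior K := by
  obtain ⟨z, hz⟩ := hne
  apply hc.openSegment_interior_self_subset_interior hz (ho z (interior_subset hz))
  refine ⟨t / (1 + t), 1 / (1 + t), by positivity, by positivity, by field_simp; ring, ?_⟩
  match_scalars <;> field_simp <;> ring

theorem prod_le_sum_div_pow {d : ℕ} (hd : 0 < d) (z : Fin d → ℝ) (hz : ∀ j, 0 ≤ z j) :
    ∏ j, z j ≤ ((∑ j, z j) / d) ^ d := by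
  have h := Real.geom_mean_le_arith_mean Finset.univ (fun _ => (1 : ℝ)) z (by simp)
    (by simpa using hd) (fun j _ => hz j)
  simp only [Real.rpow_one, Finset.sum_const, Finset.card_univ, Fintype.card_fin, nsmul_eq_mul,
    mul_one, one_mul] at h
  have hp : 0 ≤ ∏ j, z j := Finset.prod_nonneg fun j _ => hz j
  calc ∏ j, z j = ((∏ j, z j) ^ ((d : ℝ)⁻¹)) ^ d := (Real.rpow_inv_natCast_pow hp hd.ne').symm
    _ ≤ _ := pow_le_pow_left₀ (by positivity) h d

/-- The linear endomorphism of `ℝ^d` whose coordinates are the inner products with `u j`. -/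
noncomputable def innerFrameMap {d : ℕ} (u : Fin d → EuclideanSpace ℝ (Fin d)) :
    EuclideanSpace ℝ (Fin d) →ₗ[ℝ] EuclideanSpace ℝ (Fin d) :=
  Matrix.toEuclideanLin (Matrix.of fun j k => u j k)

theorem innerFrameMap_apply {d : ℕ} (u : Fin d → EuclideanSpace ℝ (Fin d))
    (x : EuclideanSpace ℝ (Fin d)) (j : Fin d) : innerFrameMap u x j = ⟪x, u j⟫ := by
  simp [innerFrameMap, Matrix.toEuclideanLin, Matrix.mulVec, dotProduct, PiLp.inner_apply]

theorem det_innerFrameMap {d : ℕ} (u : Fin d → EuclideanSpace ℝ (Fin d)) :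
    LinearMap.det (innerFrameMap u) = (Matrix.of fun j k => u j k).det := by
  exact LinearMap.det_toLin (EuclideanSpace.basisFun (Fin d) ℝ).toBasis _

theorem innerFrameMap_comp {d : ℕ} (u : Fin d → EuclideanSpace ℝ (Fin d))
    (A : EuclideanSpace ℝ (Fin d) →ₗ[ℝ] EuclideanSpace ℝ (Fin d)) :
    innerFrameMap u ∘ₗ A = innerFrameMap fun j => LinearMap.adjoint A (u j) := by
  ext x j
  simp [innerFrameMap_apply, LinearMap.adjoint_inner_right]

theorem abs_det_innerFrameMap_le {d : ℕ} (u : Fin d → EuclideanSpace ℝ (Fin d)) :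
    |LinearMap.det (innerFrameMap u)| ≤ ∏ j, ‖u j‖ := by
  have : Fact (finrank ℝ (EuclideanSpace ℝ (Fin d)) = d) := ⟨by simp⟩
  let b := EuclideanSpace.basisFun (Fin d) ℝ
  have h := b.toBasis.orientation.abs_volumeForm_apply_le u
  rw [Orientation.volumeForm_robust' _ b, Basis.det_apply] at h
  rwa [det_innerFrameMap, ← Matrix.det_transpose]

/-- Vectors of a compact set spanning a parallelepiped of the largest volume: by Cramer's rule
every other vector of the set is a combination of them with coefficients in `[-1, 1]`. -/
theorem IsCompact.exists_det_innerFrameMap_ne_zero {d : ℕ} {D : Set (EuclideanSpace ℝ (Fin d))}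
    (hD : IsCompact D) {r : ℝ} (hr : 0 < r)
    (hball : Metric.closedBall 0 r ⊆ D) :
    ∃ u : Fin d → EuclideanSpace ℝ (Fin d), (∀ j, u j ∈ D) ∧
      LinearMap.det (innerFrameMap u) ≠ 0 ∧ ∀ v ∈ D, ∀ x, |⟪x, v⟫| ≤ ∑ j, |⟪x, u j⟫| := by
  classical
  let f : (Fin d → EuclideanSpace ℝ (Fin d)) → ℝ := fun u => |LinearMap.det (innerFrameMap u)|
  have hf : Continuous f := by
    simp only [f, det_innerFrameMap]
    refine continuous_abs.comp (Continuous.matrix_det ?_)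
    refine continuous_matrix fun i j => ?_
    simp only [Matrix.of_apply]
    fun_prop
  let e : Fin d → EuclideanSpace ℝ (Fin d) := fun j => r • EuclideanSpace.single j (1 : ℝ)
  have he : ∀ j, e j ∈ D := fun j => hball (by simp [e, norm_smul, abs_of_pos hr])
  have hfe : 0 < f e := by
    have : (Matrix.of fun j k => e j k) = r • (1 : Matrix (Fin d) (Fin d) ℝ) := by
      ext j k
      simp [e, Matrix.one_apply, eq_comm]
    simp only [f, det_innerFrameMap, this]
    rw [Matrix.det_smul, Matrix.det_one]
    positivity
  obtain ⟨u, hu, hmax⟩ := (isCompact_univ_pi fun _ : Fin d => hD).exists_isMaxOn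
    ⟨e, fun j _ => he j⟩ hf.continuousOn
  have hpos : 0 < f u := hfe.trans_le (hmax (fun j _ => he j))
  refine ⟨u, fun j => hu j trivial, abs_pos.1 hpos, fun v hv x => ?_⟩
  set U : Matrix (Fin d) (Fin d) ℝ := Matrix.of fun j k => u j k with hU
  have hfu : f u = |U.det| := by simp only [f, det_innerFrameMap, hU]
  have hc : ∀ j, |Matrix.cramer U.transpose v j| ≤ |U.det| := by
    intro j
    have hm : f (Function.update u j v) ≤ f u := by
      apply hmax
      intro k _
      rcases eq_or_ne k j with rfl | hk
      · simpa using hv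
      · simpa [hk] using hu k trivial
    rw [hfu] at hm
    convert hm using 1
    simp only [f, det_innerFrameMap, Matrix.cramer_transpose_apply]
    congr 2
    ext i k
    rcases eq_or_ne i j with rfl | hi
    · simp
    · simp [hi, hU]
  have hv' : ∀ k, ∑ j, u j k * Matrix.cramer U.transpose v j = U.det * v k := by
    intro k
    have := congrFun (Matrix.mulVec_cramer U.transpose v) k
    simpa [Matrix.mulVec, dotProduct, hU] using this
  have hx : U.det * ⟪x, v⟫ = ∑ j, Matrix.cramer U.transpose v j * ⟪x, u j⟫ := by
    simp only [PiLp.inner_apply, RCLike.inner_apply, conj_trivial, Finset.mul_sum]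
    rw [Finset.sum_comm]
    refine Finset.sum_congr rfl fun k _ => ?_
    rw [← mul_assoc, ← hv', Finset.sum_mul]
    exact Finset.sum_congr rfl fun j _ => by ring
  rw [hfu] at hpos
  refine le_of_mul_le_mul_left ?_ hpos
  rw [← abs_mul, hx, Finset.mul_sum]
  refine (Finset.abs_sum_le_sum_abs _ _).trans (Finset.sum_le_sum fun j _ => ?_)
  rw [abs_mul]
  exact mul_le_mul_of_nonneg_right (hc j) (abs_nonneg _)

/-- The linear equivalence `s T⁻¹`, where `T = innerFrameMap u`, and its determinant. -/
theorem exists_linearEquiv_inner_eq_mul {d : ℕ} (u : Fin d → EuclideanSpace ℝ (Fin d))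
    (hu : LinearMap.det (innerFrameMap u) ≠ 0) {s : ℝ} (hs : 0 < s) :
    ∃ M : EuclideanSpace ℝ (Fin d) ≃ₗ[ℝ] EuclideanSpace ℝ (Fin d),
      |LinearMap.det (M : EuclideanSpace ℝ (Fin d) →ₗ[ℝ] EuclideanSpace ℝ (Fin d))| *
        |LinearMap.det (innerFrameMap u)| = s ^ d ∧
      ∀ y, ∀ j, ⟪M y, u j⟫ = s * y j := by
  let T := (innerFrameMap u).equivOfDetNeZero hu
  have hT : ∀ x, T x = innerFrameMap u x := fun x => rfl
  let M := T.symm.trans (LinearEquiv.smulOfNeZero ℝ _ s hs.ne')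
  have hM : ∀ y, M y = s • T.symm y := fun y => rfl
  have hcomp : innerFrameMap u ∘ₗ (M : EuclideanSpace ℝ (Fin d) →ₗ[ℝ] EuclideanSpace ℝ (Fin d))
      = s • LinearMap.id := by
    ext1 y
    simp [hM, ← hT]
  refine ⟨M, ?_, fun y j => ?_⟩
  · rw [← abs_mul, mul_comm, ← LinearMap.det_comp, hcomp, LinearMap.det_smul]
    simp [abs_of_pos hs]
  · rw [← innerFrameMap_apply, hM, map_smul, ← hT]
    simp

theorem AffineEquiv.volume_image {d : ℕ}
    (L : EuclideanSpace ℝ (Fin d) ≃ᵃ[ℝ] EuclideanSpace ℝ (Fin d))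
    (s : Set (EuclideanSpace ℝ (Fin d))) :
    volume (L '' s) = ENNReal.ofReal |LinearMap.det
      (L.linear : EuclideanSpace ℝ (Fin d) →ₗ[ℝ] EuclideanSpace ℝ (Fin d))| * volume s := by
  have : L '' s = (fun z => L 0 + z) '' ((L.linear : _ →ₗ[ℝ] _) '' s) := by
    rw [Set.image_image]
    refine Set.image_congr fun y _ => ?_
    simpa [add_comm] using L.map_vadd 0 y
  rw [this, Set.image_add_left, measure_preimage_add, Measure.addHaar_image_linearMap]

theorem norm_adjoint_le_of_inner_image_le {d : ℕ}
    (L : EuclideanSpace ℝ (Fin d) ≃ᵃ[ℝ] EuclideanSpace ℝ (Fin d))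
    {o v : EuclideanSpace ℝ (Fin d)}
    (h : ∀ y ∈ Metric.closedBall (0 : EuclideanSpace ℝ (Fin d)) 1, ⟪L y - o, v⟫ ≤ 1) :
    ‖LinearMap.adjoint (L.linear : EuclideanSpace ℝ (Fin d) →ₗ[ℝ] EuclideanSpace ℝ (Fin d)) v‖
      ≤ 1 - ⟪L 0 - o, v⟫ := by
  set w := LinearMap.adjoint
    (L.linear : EuclideanSpace ℝ (Fin d) →ₗ[ℝ] EuclideanSpace ℝ (Fin d)) v with hw
  have hmem : ‖w‖⁻¹ • w ∈ Metric.closedBall (0 : EuclideanSpace ℝ (Fin d)) 1 := by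
    rw [mem_closedBall_zero_iff, norm_smul, norm_inv, norm_norm]
    exact inv_mul_le_one
  have hL : L (‖w‖⁻¹ • w) = L.linear (‖w‖⁻¹ • w) + L 0 := by
    simpa using L.map_vadd 0 (‖w‖⁻¹ • w)
  have hin : ⟪L.linear (‖w‖⁻¹ • w), v⟫ = ‖w‖ := by
    have : ⟪L.linear (‖w‖⁻¹ • w), v⟫ = ⟪‖w‖⁻¹ • w, w⟫ :=
      (LinearMap.adjoint_inner_right (L.linear : _ →ₗ[ℝ] _) (‖w‖⁻¹ • w) v).symm
    rw [this, real_inner_smul_left, real_inner_self_eq_norm_sq, pow_two]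
    rcases eq_or_ne ‖w‖ 0 with h0 | h0
    · simp [h0]
    · field_simp
  have := h _ hmem
  rw [hL, add_sub_assoc, inner_add_left, hin] at this
  linarith

theorem abs_det_mul_abs_det_innerFrameMap_le {d : ℕ} (hd : 0 < d)
    (L : EuclideanSpace ℝ (Fin d) ≃ᵃ[ℝ] EuclideanSpace ℝ (Fin d))
    {o : EuclideanSpace ℝ (Fin d)} {u : Fin d → EuclideanSpace ℝ (Fin d)}
    (h : ∀ j, ∀ y ∈ Metric.closedBall (0 : EuclideanSpace ℝ (Fin d)) 1, ⟪L y - o, u j⟫ ≤ 1)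
    (hsum : -⟪L 0 - o, ∑ j, u j⟫ ≤ (d : ℝ) ^ 2) :
    |LinearMap.det (L.linear : EuclideanSpace ℝ (Fin d) →ₗ[ℝ] EuclideanSpace ℝ (Fin d))| *
      |LinearMap.det (innerFrameMap u)| ≤ (1 + (d : ℝ)) ^ d := by
  have hd0 : (0 : ℝ) < d := by exact_mod_cast hd
  have hnn : ∀ j, 0 ≤ 1 - ⟪L 0 - o, u j⟫ := fun j =>
    (norm_nonneg _).trans (norm_adjoint_le_of_inner_image_le L (h j))
  rw [← abs_mul, mul_comm, ← LinearMap.det_comp, innerFrameMap_comp]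
  calc _ ≤ _ := abs_det_innerFrameMap_le _
    _ ≤ ∏ j, (1 - ⟪L 0 - o, u j⟫) := Finset.prod_le_prod (fun _ _ => norm_nonneg _)
        fun j _ => norm_adjoint_le_of_inner_image_le L (h j)
    _ ≤ ((∑ j, (1 - ⟪L 0 - o, u j⟫)) / d) ^ d := prod_le_sum_div_pow hd _ hnn
    _ ≤ _ := by
      refine pow_le_pow_left₀ (div_nonneg (Finset.sum_nonneg fun j _ => hnn j) hd0.le) ?_ d
      rw [div_le_iff₀ hd0, Finset.sum_sub_distrib, ← inner_sum]
      simp only [Finset.sum_const, Finset.card_univ, Fintype.card_fin, nsmul_eq_mul, mul_one]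
      linarith

/-- A large parallelepiped spanned by vectors of the polar sets of the `C i` about `o`. -/
theorem exists_polar_frame {d : ℕ} {ι : Type*} [Finite ι] [Nonempty ι]
    {C : ι → Set (EuclideanSpace ℝ (Fin d))} (hconv : ∀ i, Convex ℝ (C i))
    (hbdd : ∀ i, Bornology.IsBounded (C i)) {o : EuclideanSpace ℝ (Fin d)}
    (ho : ∀ i, o ∈ interior (C i)) :
    ∃ (u : Fin d → EuclideanSpace ℝ (Fin d)) (σ : Fin d → ι),
      (∀ j, ∀ x ∈ C (σ j), ⟪x - o, u j⟫ ≤ 1) ∧ LinearMap.det (innerFrameMap u) ≠ 0 ∧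
      ∀ x, ∑ j, |⟪x, u j⟫| ≤ 1 / 2 → ∀ i, o + x ∈ interior (C i) := by
  let P : ι → Set (EuclideanSpace ℝ (Fin d)) := fun i => {v | ∀ x ∈ C i, ⟪x - o, v⟫ ≤ 1}
  have hPcl : ∀ i, IsClosed (P i) := fun i => by
    simp only [P, Set.ofPred_forall]
    exact isClosed_biInter fun x _ => isClosed_le (by fun_prop) continuous_const
  have hPb : ∀ i, Bornology.IsBounded (P i) := fun i => by
    obtain ⟨r, hr, hrC⟩ := Metric.mem_nhds_iff.1 (mem_interior_iff_mem_nhds.1 (ho i))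
    refine isBounded_iff_forall_norm_le.2 ⟨2 / r, fun v hv => ?_⟩
    rcases eq_or_ne ‖v‖ 0 with h0 | h0
    · rw [h0]; positivity
    have hvp : 0 < ‖v‖ := lt_of_le_of_ne (norm_nonneg _) h0.symm
    have := hv (o + (r / 2 / ‖v‖) • v) (hrC (by
      rw [Metric.mem_ball, dist_eq_norm, add_sub_cancel_left, norm_smul, Real.norm_eq_abs,
        abs_of_pos (by positivity), div_mul_cancel₀ _ h0]
      linarith))
    rw [add_sub_cancel_left, real_inner_smul_left, real_inner_self_eq_norm_sq] at this
    rw [le_div_iff₀ hr]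
    field_simp at this
    linarith
  have hD : IsCompact (⋃ i, P i) :=
    isCompact_iUnion fun i => Metric.isCompact_of_isClosed_isBounded (hPcl i) (hPb i)
  obtain ⟨i₀⟩ := ‹Nonempty ι›
  obtain ⟨R, hR⟩ := (hbdd i₀).subset_closedBall o
  have hball : Metric.closedBall 0 ((|R| + 1)⁻¹) ⊆ ⋃ i, P i := by
    refine fun v hv => Set.mem_iUnion.2 ⟨i₀, fun x hx => ?_⟩
    have hxR : ‖x - o‖ ≤ |R| + 1 := by
      have := hR hx
      rw [Metric.mem_closedBall, dist_eq_norm] at this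
      linarith [le_abs_self R]
    rw [mem_closedBall_zero_iff] at hv
    have hp : 0 < |R| + 1 := by positivity
    calc _ ≤ ‖x - o‖ * ‖v‖ := real_inner_le_norm _ _
      _ ≤ (|R| + 1) * (|R| + 1)⁻¹ := by gcongr
      _ = 1 := mul_inv_cancel₀ hp.ne'
  obtain ⟨u, hu, hdet, hmax⟩ := hD.exists_det_innerFrameMap_ne_zero (by positivity) hball
  choose σ hσ using fun j => Set.mem_iUnion.1 (hu j)
  refine ⟨u, σ, hσ, hdet, fun x hx i => ?_⟩
  have hcl : o + (2 : ℝ) • x ∈ closure (C i) := by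
    by_contra hnot
    obtain ⟨f, c, hfc, hcf⟩ := geometric_hahn_banach_closed_point (hconv i).closure
      isClosed_closure hnot
    have hco : 0 < c - f o := sub_pos.2 (hfc o (subset_closure (interior_subset (ho i))))
    let v := (c - f o)⁻¹ • (InnerProductSpace.toDual ℝ _).symm f
    have hv : ∀ z, ⟪z, v⟫ = (c - f o)⁻¹ * f z := fun z => by
      rw [real_inner_smul_right, real_inner_comm, InnerProductSpace.toDual_symm_apply]
    have hvP : v ∈ ⋃ i, P i := by
      refine Set.mem_iUnion.2 ⟨i, fun z hz => ?_⟩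
      rw [hv, map_sub, inv_mul_le_iff₀ hco]
      linarith [hfc z (subset_closure hz)]
    have h1 := (le_abs_self _).trans ((hmax v hvP x).trans hx)
    rw [hv, inv_mul_le_iff₀ hco] at h1
    rw [map_add, map_smul, smul_eq_mul] at hcf
    linarith
  apply (hconv i).openSegment_interior_closure_subset_interior (ho i) hcl
  refine ⟨1 / 2, 1 / 2, by norm_num, by norm_num, by norm_num, ?_⟩
  match_scalars <;> norm_num

/-- If the intersection of convex sets lies in the half-space `{x | f x ≤ c}`, then already `d` of
the sets have their intersection there, unless the whole family has an empty intersection. -/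
theorem exists_finset_card_le_biInter_subset_halfSpace {E ι : Type*} [AddCommGroup E] [Module ℝ E]
    [FiniteDimensional ℝ E] [Fintype ι] {C : ι → Set E} (hconv : ∀ i, Convex ℝ (C i))
    (hne : (⋂ i, C i).Nonempty) (f : E →ₗ[ℝ] ℝ) (c : ℝ) (hf : ∀ x ∈ ⋂ i, C i, f x ≤ c) :
    ∃ T : Finset ι, T.card ≤ finrank ℝ E ∧ ∀ x ∈ ⋂ i ∈ T, C i, f x ≤ c := by
  by_contra! hcon
  let F : Option ι → Set E := fun i => i.elim {x | c < f x} C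
  have : (⋂ i ∈ (Finset.univ : Finset (Option ι)), F i).Nonempty := by
    apply Convex.helly_theorem' (𝕜 := ℝ)
    · rintro (_ | i) -
      · exact convex_halfSpace_gt f.isLinear c
      · exact hconv i
    · intro I _ hI
      by_cases hn : none ∈ I
      · obtain ⟨x, hx, hxc⟩ := hcon (Finset.eraseNone I)
          (by rw [Finset.card_eraseNone_of_mem hn]; omega)
        refine ⟨x, Set.mem_iInter₂.2 ?_⟩
        rintro (_ | i) hi
        · exact hxc
        · exact Set.mem_iInter₂.1 hx i (Finset.mem_eraseNone.2 hi)
      · obtain ⟨x, hx⟩ := hne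
        refine ⟨x, Set.mem_iInter₂.2 ?_⟩
        rintro (_ | i) hi
        · exact absurd hi hn
        · exact Set.mem_iInter.1 hx i
  obtain ⟨x, hx⟩ := this
  simp only [Finset.mem_univ, Set.iInter_true, Set.mem_iInter] at hx
  exact absurd (hf x (Set.mem_iInter.2 fun i => hx (some i))) (not_le.2 (hx none))

theorem sum_abs_le_sqrt_mul_norm {d : ℕ} (y : EuclideanSpace ℝ (Fin d)) :
    ∑ j, |y j| ≤ √d * ‖y‖ := by
  rw [EuclideanSpace.norm_eq, ← Real.sqrt_mul (Nat.cast_nonneg d)]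
  apply Real.le_sqrt_of_sq_le
  simpa using sq_sum_le_card_mul_sum_sq (s := Finset.univ) (f := fun j => |y j|)

theorem IsEllipsoid.isCompact {d : ℕ} {E : Set (EuclideanSpace ℝ (Fin d))} (hE : IsEllipsoid E) :
    IsCompact E := by
  obtain ⟨L, rfl⟩ := hE
  exact (isCompact_closedBall 0 1).image L.continuous_of_finiteDimensional

theorem IsEllipsoid.nonempty_interior {d : ℕ} {E : Set (EuclideanSpace ℝ (Fin d))}
    (hE : IsEllipsoid E) : (interior E).Nonempty := by
  obtain ⟨L, rfl⟩ := hE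
  refine ⟨L 0, ?_⟩
  have h : L '' interior (Metric.closedBall 0 1) = interior (L '' Metric.closedBall 0 1) :=
    L.toContinuousAffineEquiv.toHomeomorph.image_interior _
  rw [← h]
  exact ⟨0, Metric.ball_subset_interior_closedBall (by simp), rfl⟩

/-- The statement for bounded sets: the polar frame about a Minkowski center of the intersection
yields an ellipsoid that is comparable with every ellipsoid in suitable `2d` of the sets. -/
theorem exists_ellipsoid_subset_iInter_of_isBounded {d : ℕ} (hd : 0 < d) {ι : Type*} [Fintype ι]
    (hcard : 2 * d ≤ Fintype.card ι) {C : ι → Set (EuclideanSpace ℝ (Fin d))}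
    (hconv : ∀ i, Convex ℝ (C i)) (hbdd : ∀ i, Bornology.IsBounded (C i))
    (h : ∀ S : Finset ι, S.card = 2 * d →
      ∃ E, IsEllipsoid E ∧ 1 ≤ volume E ∧ E ⊆ ⋂ i ∈ S, C i) :
    ∃ E, IsEllipsoid E ∧
      ENNReal.ofReal ((1 / 4) ^ d * (d : ℝ) ^ (-(3 * (d : ℝ) / 2))) ≤ volume E ∧
      E ⊆ ⋂ i, C i := by
  classical
  have hd0 : (0 : ℝ) < d := by exact_mod_cast hd
  have hd1 : (1 : ℝ) ≤ d := by exact_mod_cast hd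
  have : Nonempty ι := Fintype.card_pos_iff.1 (by omega)
  have hfin : finrank ℝ (EuclideanSpace ℝ (Fin d)) = d := by simp
  have hint : (⋂ i, interior (C i)).Nonempty := by
    have := Convex.helly_theorem (𝕜 := ℝ) (F := fun i => interior (C i)) (s := Finset.univ)
      (by rw [hfin, Finset.card_univ]; omega) (fun i _ => (hconv i).interior) (by
        intro I _ hI
        obtain ⟨S, hIS, -, hS⟩ := Finset.exists_subsuperset_card_eq (Finset.subset_univ I)
          (by omega : I.card ≤ 2 * d) (by rwa [Finset.card_univ])
        obtain ⟨E, hE, -, hES⟩ := h S hS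
        refine hE.nonempty_interior.mono fun x hx => Set.mem_iInter₂.2 fun i hi => ?_
        exact interior_mono (fun z hz => Set.mem_iInter₂.1 (hES hz) i (hIS hi)) hx)
    simpa using this
  have hKint : (interior (⋂ i, closure (C i))).Nonempty := by
    rw [interior_iInter_of_finite]
    exact hint.mono (Set.iInter_mono fun i => interior_mono subset_closure)
  have hKconv : Convex ℝ (⋂ i, closure (C i)) := convex_iInter fun i => (hconv i).closure
  have hKcomp : IsCompact (⋂ i, closure (C i)) :=
    Metric.isCompact_of_isClosed_isBounded (isClosed_iInter fun i => isClosed_closure)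
      ((hbdd (Classical.arbitrary ι)).closure.subset (Set.iInter_subset _ _))
  obtain ⟨o, -, ho⟩ := hKconv.exists_minkowski_center hKcomp (hKint.mono interior_subset) hfin hd
  have hoK := hKconv.mem_interior_of_sub_smul_mem hKint (inv_pos.2 hd0) ho
  have hoC : ∀ i, o ∈ interior (C i) := fun i => by
    rw [← (hconv i).interior_closure_eq_interior_of_nonempty_interior
      (hint.mono (Set.iInter_subset _ i))]
    exact interior_mono (Set.iInter_subset _ i) hoK
  obtain ⟨u, σ, huσ, hdet, hlarge⟩ := exists_polar_frame hconv hbdd hoC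
  have huσ' : ∀ j, ∀ x ∈ closure (C (σ j)), ⟪x - o, u j⟫ ≤ 1 := fun j =>
    closure_minimal (huσ j)
      (isClosed_le (f := fun x => ⟪x - o, u j⟫) (by fun_prop) continuous_const)
  obtain ⟨T, hT, hTC⟩ := exists_finset_card_le_biInter_subset_halfSpace hconv
    (hint.mono (Set.iInter_mono fun i => interior_subset)) (-(innerₗ _ (∑ j, u j)))
    ((d : ℝ) ^ 2 - ⟪o, ∑ j, u j⟫) (by
      intro x hx
      have hx' := ho x (Set.iInter_mono (fun i => subset_closure) hx)
      have hj : ∀ j, -⟪x - o, u j⟫ ≤ d := fun j => by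
        have := huσ' j _ (Set.mem_iInter.1 hx' (σ j))
        rw [sub_sub_cancel_left, inner_neg_left, real_inner_smul_left, ← mul_neg,
          inv_mul_le_iff₀ hd0, mul_one] at this
        exact this
      have hs : -⟪x - o, ∑ j, u j⟫ ≤ (d : ℝ) ^ 2 := by
        rw [inner_sum, ← Finset.sum_neg_distrib]
        refine (Finset.sum_le_sum fun j _ => hj j).trans (le_of_eq ?_)
        simp [pow_two]
      rw [inner_sub_left] at hs
      rw [LinearMap.neg_apply, innerₗ_apply_apply, real_inner_comm]
      linarith)
  rw [hfin] at hT
  obtain ⟨S, hTS, -, hS⟩ := Finset.exists_subsuperset_card_eq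
    (Finset.subset_univ (Finset.univ.image σ ∪ T)) (n := 2 * d) (by
      have h1 := Finset.card_union_le (Finset.univ.image σ) T
      have h2 : (Finset.univ.image σ).card ≤ d := by
        simpa using Finset.card_image_le (s := Finset.univ) (f := σ)
      omega) (by rwa [Finset.card_univ])
  obtain ⟨E, ⟨L, rfl⟩, hvol, hES⟩ := h S hS
  have hmem : ∀ y ∈ Metric.closedBall (0 : EuclideanSpace ℝ (Fin d)) 1, ∀ i ∈ S, L y ∈ C i :=
    fun y hy i hi => Set.mem_iInter₂.1 (hES ⟨y, hy, rfl⟩) i hi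
  have hbound := abs_det_mul_abs_det_innerFrameMap_le hd L (o := o) (u := u)
    (fun j y hy => huσ j _ (hmem y hy _ (hTS (Finset.mem_union_left _ (by simp))))) (by
      have := hTC (L 0) (Set.mem_iInter₂.2 fun i hi =>
        hmem 0 (by simp) i (hTS (Finset.mem_union_right _ hi)))
      rw [LinearMap.neg_apply, innerₗ_apply_apply, real_inner_comm] at this
      rw [inner_sub_left]
      linarith)
  obtain ⟨M, hMdet, hM⟩ := exists_linearEquiv_inner_eq_mul u hdet (s := 1 / (2 * √d)) (by positivity)
  let L' := M.toAffineEquiv.trans (AffineEquiv.constVAdd ℝ (EuclideanSpace ℝ (Fin d)) o)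
  refine ⟨L' '' Metric.closedBall 0 1, ⟨L', rfl⟩, ?_, ?_⟩
  · have hL' : (L'.linear : EuclideanSpace ℝ (Fin d) →ₗ[ℝ] EuclideanSpace ℝ (Fin d)) = M := rfl
    rw [AffineEquiv.volume_image] at hvol ⊢
    rw [hL']
    set a := |LinearMap.det (L.linear : EuclideanSpace ℝ (Fin d) →ₗ[ℝ] _)|
    set m := |LinearMap.det (M : EuclideanSpace ℝ (Fin d) →ₗ[ℝ] _)|
    set t := |LinearMap.det (innerFrameMap u)|
    have ht : 0 < t := abs_pos.2 hdet
    have hpow : (d : ℝ) ^ (-(3 * (d : ℝ) / 2)) = ((d : ℝ) ^ (-(3 : ℝ) / 2)) ^ d := by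
      rw [← Real.rpow_mul_natCast hd0.le]
      congr 1
      ring
    have hp : (d : ℝ) ^ (-(3 : ℝ) / 2) * d = 1 / √d := by
      rw [← Real.rpow_add_one hd0.ne', Real.sqrt_eq_rpow, one_div, ← Real.rpow_neg hd0.le]
      norm_num
    have hq : 0 ≤ (d : ℝ) ^ (-(3 : ℝ) / 2) := by positivity
    have key : (1 / 4) ^ d * (d : ℝ) ^ (-(3 * (d : ℝ) / 2)) * a ≤ m := by
      refine le_of_mul_le_mul_right ?_ ht
      rw [hMdet, hpow, mul_assoc, ← mul_pow]
      calc _ ≤ (1 / 4 * (d : ℝ) ^ (-(3 : ℝ) / 2)) ^ d * (2 * d : ℝ) ^ d := by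
            refine mul_le_mul_of_nonneg_left (hbound.trans ?_) (by positivity)
            exact pow_le_pow_left₀ (by positivity) (by linarith) d
        _ = ((d : ℝ) ^ (-(3 : ℝ) / 2) * d / 2) ^ d := by
            rw [← mul_pow]
            congr 1
            ring
        _ = _ := by
            rw [hp]
            congr 1
            field_simp
    calc _ ≤ ENNReal.ofReal ((1 / 4) ^ d * (d : ℝ) ^ (-(3 * (d : ℝ) / 2))) *
          (ENNReal.ofReal a * volume (Metric.closedBall (0 : EuclideanSpace ℝ (Fin d)) 1)) :=
          le_mul_of_one_le_right zero_le hvol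
      _ ≤ _ := by
          rw [← mul_assoc, ← ENNReal.ofReal_mul (by positivity)]
          gcongr
  · rintro _ ⟨y, hy, rfl⟩
    refine Set.mem_iInter.2 fun i => interior_subset (hlarge (M y) ?_ i)
    rw [mem_closedBall_zero_iff] at hy
    have hsd : 0 < √(d : ℝ) := Real.sqrt_pos.2 hd0
    calc ∑ j, |⟪M y, u j⟫| = 1 / (2 * √d) * ∑ j, |y j| := by
          rw [Finset.mul_sum]
          refine Finset.sum_congr rfl fun j _ => ?_
          rw [hM, abs_mul, abs_of_pos (by positivity)]
      _ ≤ 1 / (2 * √d) * (√d * 1) := by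
          gcongr
          exact (sum_abs_le_sqrt_mul_norm y).trans (by gcongr)
      _ = 1 / 2 := by field_simp

/-- Quantitative Helly Theorem in terms of ellipsoids. -/
theorem quantitative_helly_ellipsoid :
    ∃ c : ℝ, 0 < c ∧
      ∀ d : ℕ, 1 ≤ d →
        ∀ n : ℕ, 2 * d ≤ n →
          ∀ C : Fin n → Set (EuclideanSpace ℝ (Fin d)),
            (∀ i, Convex ℝ (C i)) →
            (∀ S : Finset (Fin n), S.card = 2 * d →
              ∃ E, IsEllipsoid E ∧ 1 ≤ volume E ∧ E ⊆ ⋂ i ∈ S, C i) →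
            ∃ E, IsEllipsoid E ∧
              ENNReal.ofReal (c ^ d * (d : ℝ) ^ (-(3 * (d : ℝ) / 2))) ≤
                volume E ∧
              E ⊆ ⋂ i, C i := by
  refine ⟨1 / 4, by norm_num, fun d hd n hn C hconv h => ?_⟩
  choose! E hE hvol hsub using h
  let C' : Fin n → Set (EuclideanSpace ℝ (Fin d)) := fun i =>
    convexHull ℝ (⋃ S ∈ {S : Finset (Fin n) | S.card = 2 * d ∧ i ∈ S}, E S)
  have hC' : ∀ i, C' i ⊆ C i := fun i => convexHull_min
    (Set.iUnion₂_subset fun S hS x hx => Set.mem_iInter₂.1 (hsub S hS.1 hx) i hS.2) (hconv i)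
  obtain ⟨F, hF, hFvol, hFsub⟩ := exists_ellipsoid_subset_iInter_of_isBounded hd
    (by simpa using hn) (C := C') (fun i => convex_convexHull ℝ _)
    (fun i => isBounded_convexHull.2
      ((Bornology.isBounded_biUnion (Set.toFinite _)).2 fun S hS => (hE S hS.1).isCompact.isBounded))
    (fun S hS => ⟨E S, hE S hS, hvol S hS, fun x hx => Set.mem_iInter₂.2 fun i hi =>
      subset_convexHull ℝ _ (Set.mem_iUnion₂.2 ⟨S, ⟨hS, hi⟩, hx⟩)⟩)
  exact ⟨F, hF, hFvol, hFsub.trans (Set.iInter_mono hC')⟩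
end
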